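/- arXiv:1111.4631 — 15 statements merged into one kernel-verified Lean document; each statement's English description precedes it below -/
import Mathlib

section
/- Assume m ≠ 2, let n ≥ 1, and let y₁, …, y_n ∈ L be elements with [e,y_i] ∈ I, [f,y_i] ∈ I and [h,y_i] ∈ I for all 1 ≤ i ≤ n. Then [e,y_i] = [f,y_i] = [h,y_i] = 0 for all 1 ≤ i ≤ n. (This is the paper's Lemma 2.1: if L/I ≅ sl₂ ⊕ R with R solvable and I a right irreducible sl₂-module whose dimension m+1 is not 3, then [sl₂⁻¹, R⁻¹] = 0; the paper writes the dimension restriction as m ≠ 3, the excluded case being dim I = 3, i.e., m = 2.) -/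
/-- Lemma 2.1 of the paper: In a complex (right) Leibniz algebra containing
`sl₂` together with an irreducible right `sl₂`-module `I = span{x_0,…,x_m}` (with
`dim I = m + 1 ≠ 3`, i.e. `m ≠ 2`), any elements `y₁, …, y_n` with `[e,yᵢ], [f,yᵢ],
[h,yᵢ] ∈ I` in fact satisfy `[e,yᵢ] = [f,yᵢ] = [h,yᵢ] = 0`. -/
theorem sl2_bracket_R_eq_zero
    (L : Type*) [AddCommGroup L] [Module ℂ L]
    (br : L →ₗ[ℂ] L →ₗ[ℂ] L)
    (leib : ∀ x y z : L, br x (br y z) = br (br x y) z - br (br x z) y)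
    (m : ℕ) (hm : 1 ≤ m)
    (e h f : L) (x : ℕ → L)
    (hind : LinearIndependent ℂ
      (Fin.cons e (Fin.cons h (Fin.cons f (fun i : Fin (m + 1) => x i)))))
    (heh : br e h = (2 : ℂ) • e) (hhf : br h f = (2 : ℂ) • f) (hef : br e f = h)
    (hhe : br h e = (-2 : ℂ) • e) (hfh : br f h = (-2 : ℂ) • f) (hfe : br f e = -h)
    (hee : br e e = 0) (hff : br f f = 0) (hhh : br h h = 0)
    (hxh : ∀ k ≤ m, br (x k) h = ((m : ℂ) - 2 * k) • x k)
    (hxf : ∀ k < m, br (x k) f = x (k + 1)) (hxmf : br (x m) f = 0)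
    (hxe : ∀ k, 1 ≤ k → k ≤ m →
      br (x k) e = (-(k : ℂ) * ((m : ℂ) + 1 - (k : ℂ))) • x (k - 1))
    (hx0e : br (x 0) e = 0)
    (hzx : ∀ z : L, ∀ k ≤ m, br z (x k) = 0)
    (hm2 : m ≠ 2)
    (n : ℕ) (hn : 1 ≤ n) (y : Fin n → L)
    (hey : ∀ i, br e (y i) ∈ Submodule.span ℂ (x '' {k | k ≤ m}))
    (hfy : ∀ i, br f (y i) ∈ Submodule.span ℂ (x '' {k | k ≤ m}))
    (hhy : ∀ i, br h (y i) ∈ Submodule.span ℂ (x '' {k | k ≤ m})) :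
    ∀ i, br e (y i) = 0 ∧ br f (y i) = 0 ∧ br h (y i) = 0 := by
  have key : ∀ v ∈ Submodule.span ℂ (x '' {k | k ≤ m}),
      br (br v h) h - (2 : ℂ) • br (br v e) f - (2 : ℂ) • br (br v f) e
        = ((m : ℂ) * (m + 2)) • v := by
    intro v hv
    induction hv using Submodule.span_induction with
    | mem v hv =>
      obtain ⟨k, hk, rfl⟩ := hv
      have hk : k ≤ m := hk
      have h1 : br (br (x k) h) h = (((m : ℂ) - 2 * k) * ((m : ℂ) - 2 * k)) • x k := by
        rw [hxh k hk, map_smul, LinearMap.smul_apply, hxh k hk, smul_smul]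
      have h2 : br (br (x k) e) f = (-(k : ℂ) * ((m : ℂ) + 1 - (k : ℂ))) • x k := by
        rcases Nat.eq_zero_or_pos k with rfl | hpos
        · simp [hx0e]
        · rw [hxe k hpos hk, map_smul, LinearMap.smul_apply, hxf (k - 1) (by omega),
            Nat.sub_add_cancel hpos]
      have h3 : br (br (x k) f) e = (-((k : ℂ) + 1) * ((m : ℂ) - (k : ℂ))) • x k := by
        rcases Nat.lt_or_ge k m with hlt | hge
        · rw [hxf k hlt, hxe (k + 1) (by omega) (by omega), Nat.add_sub_cancel]
          congr 1
          push_cast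
          ring
        · have : k = m := le_antisymm hk hge
          subst this
          simp [hxmf]
      rw [h1, h2, h3]
      module
    | zero => simp
    | add u v _ _ hu hv =>
      simp only [map_add, LinearMap.add_apply, smul_add]
      rw [← hu, ← hv]
      abel
    | smul c v _ hv =>
      simp only [map_smul, LinearMap.smul_apply]
      rw [smul_comm _ c v, ← hv]
      module
  have zeroI : ∀ z, ∀ v ∈ Submodule.span ℂ (x '' {k | k ≤ m}), br z v = 0 := by
    intro z v hv
    have : Submodule.span ℂ (x '' {k | k ≤ m}) ≤ LinearMap.ker (br z) := by
      rw [Submodule.span_le]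
      rintro _ ⟨k, hk, rfl⟩
      exact hzx z k hk
    exact this hv
  intro i
  have hom : ∀ a b, br b (y i) ∈ Submodule.span ℂ (x '' {k | k ≤ m}) →
      br (br a (y i)) b = br (br a b) (y i) := by
    intro a b hb
    have := leib a b (y i)
    rw [zeroI a _ hb] at this
    exact (sub_eq_zero.mp this.symm).symm
  have Ee := hom e e (hey i)
  have Eh := hom e h (hhy i)
  have Ef := hom e f (hfy i)
  have He := hom h e (hey i)
  have Hf := hom h f (hfy i)
  simp only [hee, heh, hef, hhe, hhf, map_smul, map_zero, LinearMap.smul_apply,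
    LinearMap.zero_apply] at Ee Eh Ef He Hf
  have hE := key _ (hey i)
  rw [Eh, Ee, Ef, He, map_smul, LinearMap.smul_apply, Eh, map_zero,
    LinearMap.zero_apply] at hE
  have hE' : ((m : ℂ) * (m + 2) - 8) • br e (y i) = 0 := by
    rw [sub_smul, ← hE]
    module
  have hne : ((m : ℂ) * (m + 2) - 8) ≠ 0 := by
    intro h0
    have h1 : ((m : ℂ) - 2) * ((m : ℂ) + 4) = 0 := by linear_combination h0
    rcases mul_eq_zero.mp h1 with h2 | h2
    · exact hm2 (by exact_mod_cast sub_eq_zero.mp h2)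
    · have : ((m + 4 : ℕ) : ℂ) = 0 := by push_cast; exact h2
      have := Nat.cast_eq_zero.mp this
      omega
  have E0 : br e (y i) = 0 := (smul_eq_zero.mp hE').resolve_left hne
  have H0 : br h (y i) = 0 := by rw [← Ef, E0]; simp
  have F0 : br f (y i) = 0 := by
    rw [H0] at Hf
    simpa using Hf.symm
  exact ⟨E0, F0, H0⟩
end

section
/- If y ∈ L satisfies [e,y] ∈ I, then [e,y] is a scalar multiple of x_0. -/
/-- If `y ∈ L` satisfies `[e,y] ∈ I`, then `[e,y]` is a scalar multiple of `x₀`. -/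
theorem bracket_e_y_is_multiple_of_x0
    (L : Type*) [AddCommGroup L] [Module ℂ L]
    (br : L →ₗ[ℂ] L →ₗ[ℂ] L)
    (leib : ∀ x y z : L, br x (br y z) = br (br x y) z - br (br x z) y)
    (m : ℕ) (hm : 1 ≤ m)
    (e h f : L) (x : ℕ → L)
    (hind : LinearIndependent ℂ
      (Fin.cons e (Fin.cons h (Fin.cons f (fun i : Fin (m + 1) => x i)))))
    (heh : br e h = (2 : ℂ) • e) (hhf : br h f = (2 : ℂ) • f) (hef : br e f = h)
    (hhe : br h e = (-2 : ℂ) • e) (hfh : br f h = (-2 : ℂ) • f) (hfe : br f e = -h)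
    (hee : br e e = 0) (hff : br f f = 0) (hhh : br h h = 0)
    (hxh : ∀ k ≤ m, br (x k) h = ((m : ℂ) - 2 * k) • x k)
    (hxf : ∀ k < m, br (x k) f = x (k + 1)) (hxmf : br (x m) f = 0)
    (hxe : ∀ k, 1 ≤ k → k ≤ m →
      br (x k) e = (-(k : ℂ) * ((m : ℂ) + 1 - (k : ℂ))) • x (k - 1))
    (hx0e : br (x 0) e = 0)
    (hzx : ∀ z : L, ∀ k ≤ m, br z (x k) = 0)
    (y : L) (hey : br e y ∈ Submodule.span ℂ (x '' {k | k ≤ m}))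
    :
    ∃ α : ℂ, br e y = α • x 0 := by
  have hI : ∀ v ∈ Submodule.span ℂ (x '' {k | k ≤ m}), br e v = 0 := by
    intro v hv
    induction hv using Submodule.span_induction with
    | mem w hw => obtain ⟨k, hk, rfl⟩ := hw; exact hzx e k hk
    | zero => simp
    | add a b _ _ ha hb => rw [map_add, ha, hb, add_zero]
    | smul a b _ hb => rw [map_smul, hb, smul_zero]
  have hve : br (br e y) e = 0 := by
    have h1 := leib e e y
    rw [hI _ hey, hee] at h1
    simpa using h1.symm
  have hli : LinearIndependent ℂ (fun i : Fin m => x i) := by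
    have h2 := hind.comp (fun i : Fin m => i.castSucc.succ.succ.succ) (by
      intro a b hab
      simpa using hab)
    exact h2
  have himg : x '' {k | k ≤ m} = Set.range (fun i : Fin (m + 1) => x i) := by
    ext w
    constructor
    · rintro ⟨k, hk, rfl⟩
      exact ⟨⟨k, Nat.lt_succ_of_le hk⟩, rfl⟩
    · rintro ⟨i, rfl⟩
      exact ⟨i, Nat.le_of_lt_succ i.2, rfl⟩
  rw [himg, Submodule.mem_span_range_iff_exists_fun] at hey
  obtain ⟨c, hc⟩ := hey
  rw [Fin.sum_univ_succ] at hc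
  have hsum : ∑ i : Fin m, (c i.succ * (-((i : ℂ) + 1) * ((m : ℂ) - i))) • x i = 0 := by
    rw [← hve, ← hc]
    simp only [map_add, map_sum, map_smul, LinearMap.add_apply, LinearMap.sum_apply,
      LinearMap.smul_apply, Fin.val_zero, hx0e, smul_zero, zero_add]
    refine Finset.sum_congr rfl fun i _ => ?_
    rw [hxe _ (by simp) (by have := i.2; simp only [Fin.val_succ]; omega), smul_smul]
    simp only [Fin.val_succ, Nat.add_sub_cancel]
    congr 2
    push_cast
    ring
  have hz := Fintype.linearIndependent_iff.mp hli _ hsum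
  have hc0 : ∀ i : Fin m, c i.succ = 0 := by
    intro i
    have h3 := hz i
    have h4 : ((i : ℂ) + 1) ≠ 0 := Nat.cast_add_one_ne_zero _
    have h5 : ((m : ℂ) - i) ≠ 0 := by
      rw [sub_ne_zero]
      exact_mod_cast i.2.ne'
    simpa [h4, h5, -neg_add_rev] using h3
  refine ⟨c 0, ?_⟩
  rw [← hc]
  simp [hc0]
end

section
/- If y ∈ L satisfies [e,y] ∈ I and [h,y] ∈ I, then there exists α ∈ ℂ such that [e,y] = α·x_0 and [h,y] = α·x_1, and moreover (2−m)·α = 0; in particular, if m ≠ 2 then [e,y] = [h,y] = 0. -/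
/-- If `y ∈ L` satisfies `[e,y] ∈ I` and `[h,y] ∈ I`, then there is `α ∈ ℂ` with `[e,y] = α•x₀`, `[h,y] = α•x₁` and `(2-m)α = 0`; in particular if `m ≠ 2` then `[e,y] = [h,y] = 0`. -/
theorem bracket_e_h_y_scalar
    (L : Type*) [AddCommGroup L] [Module ℂ L]
    (br : L →ₗ[ℂ] L →ₗ[ℂ] L)
    (leib : ∀ x y z : L, br x (br y z) = br (br x y) z - br (br x z) y)
    (m : ℕ) (hm : 1 ≤ m)
    (e h f : L) (x : ℕ → L)
    (hind : LinearIndependent ℂ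
      (Fin.cons e (Fin.cons h (Fin.cons f (fun i : Fin (m + 1) => x i)))))
    (heh : br e h = (2 : ℂ) • e) (hhf : br h f = (2 : ℂ) • f) (hef : br e f = h)
    (hhe : br h e = (-2 : ℂ) • e) (hfh : br f h = (-2 : ℂ) • f) (hfe : br f e = -h)
    (hee : br e e = 0) (hff : br f f = 0) (hhh : br h h = 0)
    (hxh : ∀ k ≤ m, br (x k) h = ((m : ℂ) - 2 * k) • x k)
    (hxf : ∀ k < m, br (x k) f = x (k + 1)) (hxmf : br (x m) f = 0)
    (hxe : ∀ k, 1 ≤ k → k ≤ m →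
      br (x k) e = (-(k : ℂ) * ((m : ℂ) + 1 - (k : ℂ))) • x (k - 1))
    (hx0e : br (x 0) e = 0)
    (hzx : ∀ z : L, ∀ k ≤ m, br z (x k) = 0)
    (y : L) (hey : br e y ∈ Submodule.span ℂ (x '' {k | k ≤ m})) (hhy : br h y ∈ Submodule.span ℂ (x '' {k | k ≤ m}))
    :
    (∃ α : ℂ, br e y = α • x 0 ∧ br h y = α • x 1 ∧ (2 - (m : ℂ)) * α = 0) ∧
    (m ≠ 2 → br e y = 0 ∧ br h y = 0) := by
  have indx : ∀ c : ℕ → ℂ, ∑ k ∈ Finset.range (m + 1), c k • x k = 0 → ∀ k ≤ m, c k = 0 := by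
    intro c hc k hk
    have h1 := hind.comp (fun i : Fin (m + 1) => i.succ.succ.succ)
      (fun a b hab => by simpa using hab)
    have h2 : LinearIndependent ℂ (fun i : Fin (m + 1) => x i) := by
      exact h1
    rw [Fintype.linearIndependent_iff] at h2
    exact h2 (fun i => c i) (by rw [← hc, Finset.sum_range]) ⟨k, by omega⟩
  have repr : ∀ v ∈ Submodule.span ℂ (x '' {k | k ≤ m}),
      ∃ b : ℕ → ℂ, v = ∑ k ∈ Finset.range (m + 1), b k • x k := by
    intro v hv
    induction hv using Submodule.span_induction with
    | mem v hv =>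
      obtain ⟨k, hk, rfl⟩ := hv
      refine ⟨fun j => if j = k then 1 else 0, ?_⟩
      have hk' : k ≤ m := hk
      have : k < m + 1 := by omega
      simp [this]
    | zero => exact ⟨0, by simp⟩
    | add v w _ _ hv hw =>
      obtain ⟨b, rfl⟩ := hv
      obtain ⟨c, rfl⟩ := hw
      exact ⟨b + c, by simp [add_smul, Finset.sum_add_distrib]⟩
    | smul a v _ hv =>
      obtain ⟨b, rfl⟩ := hv
      exact ⟨a • b, by simp [Finset.smul_sum, mul_smul]⟩
  have ann : ∀ v ∈ Submodule.span ℂ (x '' {k | k ≤ m}), ∀ z, br z v = 0 := by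
    intro v hv z
    have : Submodule.span ℂ (x '' {k | k ≤ m}) ≤ LinearMap.ker (br z) := by
      rw [Submodule.span_le]
      rintro _ ⟨k, hk, rfl⟩
      exact hzx z k hk
    exact this hv
  have ce : ∀ z, br (br z e) y = br (br z y) e := fun z => by
    have := leib z e y
    rw [ann _ hey] at this
    exact sub_eq_zero.mp this.symm
  have ch : ∀ z, br (br z h) y = br (br z y) h := fun z => by
    have := leib z h y
    rw [ann _ hhy] at this
    exact sub_eq_zero.mp this.symm
  have bre : ∀ b : ℕ → ℂ, br (∑ k ∈ Finset.range (m + 1), b k • x k) e =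
      ∑ k ∈ Finset.range (m + 1), (-((k : ℂ) + 1) * ((m : ℂ) - k) * b (k + 1)) • x k := by
    intro b
    rw [Finset.sum_range_succ', Finset.sum_range_succ]
    simp only [map_add, map_sum, map_smul, LinearMap.add_apply, LinearMap.sum_apply,
      LinearMap.smul_apply, hx0e, smul_zero, sub_self, mul_zero, zero_mul, zero_smul, add_zero]
    refine Finset.sum_congr rfl fun k hk => ?_
    have := Finset.mem_range.mp hk
    rw [hxe (k + 1) (by omega) (by omega), smul_smul, Nat.add_sub_cancel]
    congr 1
    push_cast
    ring
  have ne : ∀ k, k < m → -((k : ℂ) + 1) * ((m : ℂ) - k) ≠ 0 := by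
    intro k hk
    refine mul_ne_zero (neg_ne_zero.mpr (by exact_mod_cast k.succ_ne_zero)) ?_
    rw [sub_ne_zero]
    exact_mod_cast (by omega : m ≠ k)
  have brh : ∀ b : ℕ → ℂ, br (∑ k ∈ Finset.range (m + 1), b k • x k) h =
      ∑ k ∈ Finset.range (m + 1), (b k * ((m : ℂ) - 2 * k)) • x k := by
    intro b
    simp only [map_sum, map_smul, LinearMap.sum_apply, LinearMap.smul_apply]
    refine Finset.sum_congr rfl fun k hk => ?_
    have := Finset.mem_range.mp hk
    rw [hxh k (by omega), smul_smul]
  have hm0 : (m : ℂ) ≠ 0 := by exact_mod_cast (by omega : m ≠ 0)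
  have x0 : x 0 ≠ 0 := by
    intro h0
    have := indx (fun k => if k = 0 then 1 else 0) (by simp [h0]) 0 (by omega)
    simp at this
  obtain ⟨a, ha⟩ := repr _ hey
  obtain ⟨b, hb⟩ := repr _ hhy
  have hu : br e y = a 0 • x 0 := by
    have h1 := ce e
    rw [hee, map_zero, LinearMap.zero_apply, ha, bre] at h1
    have h2 := indx _ h1.symm
    rw [ha, Finset.sum_range_succ', Finset.sum_eq_zero, zero_add]
    intro k hk
    have hk := Finset.mem_range.mp hk
    rw [(mul_eq_zero.mp (h2 k hk.le)).resolve_left (ne k hk), zero_smul]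
  have h2m : (2 - (m : ℂ)) * a 0 = 0 := by
    have h1 := ch e
    rw [heh, map_smul, LinearMap.smul_apply, hu, map_smul, LinearMap.smul_apply,
      hxh 0 (by omega), smul_smul, smul_smul, ← sub_eq_zero, ← sub_smul] at h1
    have := (smul_eq_zero.mp h1).resolve_right x0
    push_cast at this
    linear_combination this
  have hb0 : b 0 = 0 := by
    have h1 := ch h
    rw [hhh, map_zero, LinearMap.zero_apply, hb, brh] at h1
    have h2 := indx _ h1.symm 0 (by omega)
    simpa [hm0] using h2
  have hv : ∀ k ≤ m, -((k : ℂ) + 1) * ((m : ℂ) - k) * b (k + 1) +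
      (if k = 0 then 2 * a 0 else 0) = 0 := by
    have h1 := ce h
    rw [hhe, map_smul, LinearMap.smul_apply, hu, hb, bre] at h1
    refine indx _ ?_
    simp only [add_smul, Finset.sum_add_distrib, ← h1]
    simp [smul_smul]
  have hb1 : b 1 = a 0 := by
    have h1 := hv 0 (by omega)
    simp at h1
    apply mul_left_cancel₀ hm0
    linear_combination -h1 + h2m
  have hvy : br h y = a 0 • x 1 := by
    rw [hb, Finset.sum_range_succ', hb0, zero_smul, add_zero,
      Finset.sum_eq_single_of_mem 0 (Finset.mem_range.mpr (by omega)), zero_add, hb1]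
    intro k hk hk0
    have hk := Finset.mem_range.mp hk
    have h1 := hv k hk.le
    rw [if_neg hk0, add_zero] at h1
    rw [(mul_eq_zero.mp h1).resolve_left (ne k hk), zero_smul]
  refine ⟨⟨a 0, hu, hvy, h2m⟩, fun hm2 => ?_⟩
  have : a 0 = 0 := by
    refine (mul_eq_zero.mp h2m).resolve_left (sub_ne_zero.mpr ?_)
    exact_mod_cast hm2.symm
  rw [hu, hvy, this]
  simp
end

section
/- If y ∈ L satisfies [e,y] = 0, [h,y] = 0 and [f,y] ∈ I, then [f,y] = 0. -/
/-- If `y ∈ L` satisfies `[e,y] = 0`, `[h,y] = 0` and `[f,y] ∈ I`, then `[f,y] = 0`. -/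
theorem bracket_f_y_eq_zero
    (L : Type*) [AddCommGroup L] [Module ℂ L]
    (br : L →ₗ[ℂ] L →ₗ[ℂ] L)
    (leib : ∀ x y z : L, br x (br y z) = br (br x y) z - br (br x z) y)
    (m : ℕ) (hm : 1 ≤ m)
    (e h f : L) (x : ℕ → L)
    (hind : LinearIndependent ℂ
      (Fin.cons e (Fin.cons h (Fin.cons f (fun i : Fin (m + 1) => x i)))))
    (heh : br e h = (2 : ℂ) • e) (hhf : br h f = (2 : ℂ) • f) (hef : br e f = h)
    (hhe : br h e = (-2 : ℂ) • e) (hfh : br f h = (-2 : ℂ) • f) (hfe : br f e = -h)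
    (hee : br e e = 0) (hff : br f f = 0) (hhh : br h h = 0)
    (hxh : ∀ k ≤ m, br (x k) h = ((m : ℂ) - 2 * k) • x k)
    (hxf : ∀ k < m, br (x k) f = x (k + 1)) (hxmf : br (x m) f = 0)
    (hxe : ∀ k, 1 ≤ k → k ≤ m →
      br (x k) e = (-(k : ℂ) * ((m : ℂ) + 1 - (k : ℂ))) • x (k - 1))
    (hx0e : br (x 0) e = 0)
    (hzx : ∀ z : L, ∀ k ≤ m, br z (x k) = 0)
    (y : L) (hey : br e y = 0) (hhy : br h y = 0) (hfy : br f y ∈ Submodule.span ℂ (x '' {k | k ≤ m}))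
    :
    br f y = 0 := by
  have h1 : br (br f y) h = (-2 : ℂ) • br f y := by
    have := leib f h y
    rw [hhy, hfh] at this
    simp only [map_zero, map_smul, LinearMap.smul_apply] at this
    exact (sub_eq_zero.mp this.symm).symm
  have h2 : br (br f y) e = 0 := by
    have := leib f e y
    rw [hey, hfe] at this
    simpa [hhy] using this
  have hx : LinearIndependent ℂ (fun i : Fin (m + 1) => x i) := by
    have := hind.comp (fun i : Fin (m + 1) => i.succ.succ.succ) (by
      intro a b hab
      simpa using hab)
    exact this
  have himg : x '' {k | k ≤ m} = Set.range (fun i : Fin (m + 1) => x i) := by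
    ext z
    constructor
    · rintro ⟨k, hk, rfl⟩
      exact ⟨⟨k, Nat.lt_succ_of_le hk⟩, rfl⟩
    · rintro ⟨i, rfl⟩
      exact ⟨i, Nat.le_of_lt_succ i.2, rfl⟩
  rw [himg, Submodule.mem_span_range_iff_exists_fun] at hfy
  obtain ⟨c, hc⟩ := hfy
  have hx' : LinearIndependent ℂ (fun i : Fin m => x i) := by
    exact hx.comp Fin.castSucc (Fin.castSucc_injective m)
  have hc0 : ∀ i : Fin m, c i.succ = 0 := by
    have h3 : ∑ i : Fin m, (c i.succ * (-((i : ℂ) + 1) * ((m : ℂ) - i))) • x i = 0 := by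
      rw [← h2, ← hc, Fin.sum_univ_succ]
      simp only [map_add, map_sum, map_smul, LinearMap.add_apply, LinearMap.sum_apply,
        LinearMap.smul_apply]
      simp only [Fin.val_zero, hx0e, smul_zero, zero_add]
      refine Finset.sum_congr rfl fun i _ => ?_
      rw [hxe _ (by simp) (by simpa using i.2), smul_smul]
      simp
    intro i
    have h4 := Fintype.linearIndependent_iff.mp hx' _ h3 i
    have h5 : ((i : ℕ) : ℂ) + 1 ≠ 0 := Nat.cast_add_one_ne_zero _
    have h6 : (m : ℂ) - (i : ℕ) ≠ 0 := by
      rw [sub_ne_zero]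
      exact_mod_cast i.2.ne'
    rcases mul_eq_zero.mp h4 with h7 | h7
    · exact h7
    · exact absurd h7 (mul_ne_zero (neg_ne_zero.mpr h5) h6)
  have hw : br f y = c 0 • x 0 := by
    rw [← hc, Fin.sum_univ_succ]
    simp [hc0]
  have h8 : br (br f y) h = (m : ℂ) • br f y := by
    rw [hw, map_smul, LinearMap.smul_apply, hxh 0 (Nat.zero_le _), smul_comm]
    simp
  have h9 : ((m : ℂ) + 2) • br f y = 0 := by
    rw [add_smul, ← h8, h1, ← add_smul]
    simp
  have h10 : (m : ℂ) + 2 ≠ 0 := by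
    exact_mod_cast (by omega : m + 2 ≠ 0)
  exact (smul_eq_zero.mp h9).resolve_left h10
end

section
/- If y ∈ L satisfies [h,y] = 0 and [x_k,y] ∈ I for all 0 ≤ k ≤ m, then for each 0 ≤ k ≤ m the bracket [x_k,y] is a scalar multiple of x_k. -/
/-- If `y ∈ L` satisfies `[h,y] = 0` and `[x_k,y] ∈ I` for all `0 ≤ k ≤ m`, then each `[x_k,y]` is a scalar multiple of `x_k`. -/
theorem bracket_xk_y_is_multiple_of_xk
    (L : Type*) [AddCommGroup L] [Module ℂ L]
    (br : L →ₗ[ℂ] L →ₗ[ℂ] L)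
    (leib : ∀ x y z : L, br x (br y z) = br (br x y) z - br (br x z) y)
    (m : ℕ) (hm : 1 ≤ m)
    (e h f : L) (x : ℕ → L)
    (hind : LinearIndependent ℂ
      (Fin.cons e (Fin.cons h (Fin.cons f (fun i : Fin (m + 1) => x i)))))
    (heh : br e h = (2 : ℂ) • e) (hhf : br h f = (2 : ℂ) • f) (hef : br e f = h)
    (hhe : br h e = (-2 : ℂ) • e) (hfh : br f h = (-2 : ℂ) • f) (hfe : br f e = -h)
    (hee : br e e = 0) (hff : br f f = 0) (hhh : br h h = 0)
    (hxh : ∀ k ≤ m, br (x k) h = ((m : ℂ) - 2 * k) • x k)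
    (hxf : ∀ k < m, br (x k) f = x (k + 1)) (hxmf : br (x m) f = 0)
    (hxe : ∀ k, 1 ≤ k → k ≤ m →
      br (x k) e = (-(k : ℂ) * ((m : ℂ) + 1 - (k : ℂ))) • x (k - 1))
    (hx0e : br (x 0) e = 0)
    (hzx : ∀ z : L, ∀ k ≤ m, br z (x k) = 0)
    (y : L) (hhy : br h y = 0)
    (hxy : ∀ k ≤ m, br (x k) y ∈ Submodule.span ℂ (x '' {k | k ≤ m}))
    :
    ∀ k ≤ m, ∃ c : ℂ, br (x k) y = c • x k := by
  intro k hk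
  have hli : LinearIndependent ℂ (fun i : Fin (m + 1) => x i) := by
    have h1 := hind.comp (fun i : Fin (m + 1) => i.succ.succ.succ) (by
      intro a b hab
      simpa using hab)
    exact h1
  have hset : x '' {k | k ≤ m} = Set.range (fun i : Fin (m + 1) => x i) := by
    ext z
    constructor
    · rintro ⟨j, hj, rfl⟩
      exact ⟨⟨j, Nat.lt_succ_of_le hj⟩, rfl⟩
    · rintro ⟨j, rfl⟩
      exact ⟨j, Nat.le_of_lt_succ j.2, rfl⟩
  have hmem := hxy k hk
  rw [hset, Submodule.mem_span_range_iff_exists_fun] at hmem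
  obtain ⟨c, hc⟩ := hmem
  have heig : br (br (x k) y) h = ((m : ℂ) - 2 * k) • br (x k) y := by
    have h1 := leib (x k) h y
    rw [hhy, hxh k hk, map_zero, map_smul, LinearMap.smul_apply] at h1
    exact (sub_eq_zero.mp h1.symm).symm
  have hsum : ∑ i : Fin (m + 1), (c i * (2 * ((k : ℂ) - (i : ℕ)))) • x i = 0 := by
    rw [← hc, map_sum, LinearMap.sum_apply, Finset.smul_sum, ← sub_eq_zero,
      ← Finset.sum_sub_distrib] at heig
    rw [← heig]
    refine Finset.sum_congr rfl fun i _ => ?_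
    rw [map_smul, LinearMap.smul_apply, hxh i (Nat.le_of_lt_succ i.2), smul_smul, smul_smul,
      ← sub_smul]
    congr 1
    ring
  have hz := Fintype.linearIndependent_iff.mp hli _ hsum
  refine ⟨c ⟨k, Nat.lt_succ_of_le hk⟩, ?_⟩
  rw [← hc]
  refine Finset.sum_eq_single (⟨k, Nat.lt_succ_of_le hk⟩ : Fin (m + 1)) ?_ (by simp)
  intro i _ hi
  have hne : (k : ℂ) - (i : ℕ) ≠ 0 := by
    rw [sub_ne_zero]
    intro hh
    exact hi (Fin.ext (Nat.cast_injective hh).symm)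
  have : c i = 0 := by
    rcases mul_eq_zero.mp (hz i) with h1 | h1
    · exact h1
    · exact absurd h1 (mul_ne_zero two_ne_zero hne)
  rw [this, zero_smul]
end

section
/- Under these hypotheses, [x_k,y₁] = 0 for all 0 ≤ k ≤ m; that is, [I, y₁] = 0. -/
/-- Under the hypotheses of the main theorem, `[x_k, y₁] = 0` for all `0 ≤ k ≤ m`, i.e. `[I, y₁] = 0`. -/
theorem bracket_I_y1_eq_zero
    (L : Type*) [AddCommGroup L] [Module ℂ L]
    (br : L →ₗ[ℂ] L →ₗ[ℂ] L)
    (leib : ∀ x y z : L, br x (br y z) = br (br x y) z - br (br x z) y)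
    (m : ℕ) (hm : 1 ≤ m)
    (e h f : L) (x : ℕ → L)
    (hind : LinearIndependent ℂ
      (Fin.cons e (Fin.cons h (Fin.cons f (fun i : Fin (m + 1) => x i)))))
    (heh : br e h = (2 : ℂ) • e) (hhf : br h f = (2 : ℂ) • f) (hef : br e f = h)
    (hhe : br h e = (-2 : ℂ) • e) (hfh : br f h = (-2 : ℂ) • f) (hfe : br f e = -h)
    (hee : br e e = 0) (hff : br f f = 0) (hhh : br h h = 0)
    (hxh : ∀ k ≤ m, br (x k) h = ((m : ℂ) - 2 * k) • x k)
    (hxf : ∀ k < m, br (x k) f = x (k + 1)) (hxmf : br (x m) f = 0)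
    (hxe : ∀ k, 1 ≤ k → k ≤ m →
      br (x k) e = (-(k : ℂ) * ((m : ℂ) + 1 - (k : ℂ))) • x (k - 1))
    (hx0e : br (x 0) e = 0)
    (hzx : ∀ z : L, ∀ k ≤ m, br z (x k) = 0)
    (y₁ y₂ : L)
    (hey1 : br e y₁ = 0) (hfy1 : br f y₁ = 0) (hhy1 : br h y₁ = 0)
    (hey2 : br e y₂ = 0) (hfy2 : br f y₂ = 0) (hhy2 : br h y₂ = 0)
    (hy1e : br y₁ e ∈ Submodule.span ℂ (x '' {k | k ≤ m}))
    (hy1f : br y₁ f ∈ Submodule.span ℂ (x '' {k | k ≤ m}))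
    (hy1h : br y₁ h ∈ Submodule.span ℂ (x '' {k | k ≤ m}))
    (hy1y1 : br y₁ y₁ ∈ Submodule.span ℂ (x '' {k | k ≤ m}))
    (hy2e : br y₂ e ∈ Submodule.span ℂ (x '' {k | k ≤ m}))
    (hy2f : br y₂ f ∈ Submodule.span ℂ (x '' {k | k ≤ m}))
    (hy2h : br y₂ h ∈ Submodule.span ℂ (x '' {k | k ≤ m}))
    (hy2y2 : br y₂ y₂ ∈ Submodule.span ℂ (x '' {k | k ≤ m}))
    (hxy1 : ∀ k ≤ m, br (x k) y₁ ∈ Submodule.span ℂ (x '' {k | k ≤ m}))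
    (hxy2 : ∀ k ≤ m, br (x k) y₂ ∈ Submodule.span ℂ (x '' {k | k ≤ m}))
    (hy12 : br y₁ y₂ - y₁ ∈ Submodule.span ℂ (x '' {k | k ≤ m}))
    (hy21 : br y₂ y₁ = -y₁)
    :
    ∀ k ≤ m, br (x k) y₁ = 0 := by
  have hli : LinearIndependent ℂ (fun i : Fin (m + 1) => x i) := by
    have := hind.comp (fun i : Fin (m + 1) => i.succ.succ.succ) (by
      intro a b hab
      simpa using hab)
    have h2 : (Fin.cons e (Fin.cons h (Fin.cons f (fun i : Fin (m + 1) => x i))) :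
        Fin (m + 1 + 1 + 1 + 1) → L) ∘
        (fun i : Fin (m + 1) => i.succ.succ.succ) = (fun i : Fin (m + 1) => x i) := by
      funext i
      simp
    exact h2 ▸ this
  have key : ∀ v ∈ Submodule.span ℂ (x '' {k | k ≤ m}), br v h = (m : ℂ) • v →
      ∃ c : ℂ, v = c • x 0 := by
    intro v hv hvh
    have hs : x '' {k | k ≤ m} = Set.range (fun i : Fin (m + 1) => x i) := by
      ext z
      constructor
      · rintro ⟨k, hk, rfl⟩
        exact ⟨⟨k, Nat.lt_succ_of_le hk⟩, rfl⟩
      · rintro ⟨i, rfl⟩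
        exact ⟨i, Nat.le_of_lt_succ i.2, rfl⟩
    rw [hs, Submodule.mem_span_range_iff_exists_fun] at hv
    obtain ⟨c, rfl⟩ := hv
    have h0 : ∑ i : Fin (m + 1), (c i * (2 * (i : ℕ) : ℂ)) • x i = 0 := by
      have h1 : ∀ i : Fin (m + 1), (c i * (2 * (i : ℕ) : ℂ)) • x i
          = (m : ℂ) • (c i • x i) - br (c i • x i) h := by
        intro i
        rw [map_smul, LinearMap.smul_apply, hxh i (Nat.le_of_lt_succ i.2)]
        module
      rw [Finset.sum_congr rfl (fun i _ => h1 i), Finset.sum_sub_distrib, ← Finset.smul_sum,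
        ← hvh, map_sum, LinearMap.sum_apply, sub_self]
    have h3 := Fintype.linearIndependent_iff.mp hli _ h0
    refine ⟨c 0, ?_⟩
    rw [Finset.sum_eq_single (0 : Fin (m + 1))]
    · simp
    · intro i _ hi
      have h4 := h3 i
      have h5 : ((i : ℕ) : ℂ) ≠ 0 := by
        intro h6
        apply hi
        ext
        simpa using h6
      have h6 : c i = 0 := by
        simpa [h5, hi] using h4
      rw [h6, zero_smul]
    · simp
  have comm : ∀ y g z : L, br g y = 0 → br (br z y) g = br (br z g) y := by
    intro y g z hg
    have := leib z g y
    rw [hg, map_zero] at this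
    exact (sub_eq_zero.mp this.symm).symm
  have eig : ∀ y : L, br h y = 0 → br (x 0) y ∈ Submodule.span ℂ (x '' {k | k ≤ m}) →
      ∃ c : ℂ, br (x 0) y = c • x 0 := by
    intro y hy hm0
    refine key _ hm0 ?_
    rw [comm y h _ hy, hxh 0 (Nat.zero_le m)]
    simp
  obtain ⟨a, ha⟩ := eig y₁ hhy1 (hxy1 0 (Nat.zero_le m))
  obtain ⟨b, hb⟩ := eig y₂ hhy2 (hxy2 0 (Nat.zero_le m))
  intro k
  induction k with
  | zero =>
    intro _
    have := leib (x 0) y₂ y₁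
    rw [hy21, ha, hb, map_smul, map_smul, LinearMap.smul_apply, LinearMap.smul_apply, ha, hb,
      map_neg, smul_smul, smul_smul, mul_comm, sub_self] at this
    exact neg_eq_zero.mp this
  | succ k ih =>
    intro hk
    rw [← hxf k hk, ← comm y₁ f _ hfy1, ih (Nat.le_of_lt hk)]
    simp
end

section
/- Under these hypotheses, there exists a ∈ ℂ such that [x_k,y₂] = a·x_k for all 0 ≤ k ≤ m. -/
/-- Under the hypotheses of the main theorem, there exists `a ∈ ℂ` such that `[x_k, y₂] = a•x_k` for all `0 ≤ k ≤ m`. -/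
theorem bracket_I_y2_scalar
    (L : Type*) [AddCommGroup L] [Module ℂ L]
    (br : L →ₗ[ℂ] L →ₗ[ℂ] L)
    (leib : ∀ x y z : L, br x (br y z) = br (br x y) z - br (br x z) y)
    (m : ℕ) (hm : 1 ≤ m)
    (e h f : L) (x : ℕ → L)
    (hind : LinearIndependent ℂ
      (Fin.cons e (Fin.cons h (Fin.cons f (fun i : Fin (m + 1) => x i)))))
    (heh : br e h = (2 : ℂ) • e) (hhf : br h f = (2 : ℂ) • f) (hef : br e f = h)
    (hhe : br h e = (-2 : ℂ) • e) (hfh : br f h = (-2 : ℂ) • f) (hfe : br f e = -h)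
    (hee : br e e = 0) (hff : br f f = 0) (hhh : br h h = 0)
    (hxh : ∀ k ≤ m, br (x k) h = ((m : ℂ) - 2 * k) • x k)
    (hxf : ∀ k < m, br (x k) f = x (k + 1)) (hxmf : br (x m) f = 0)
    (hxe : ∀ k, 1 ≤ k → k ≤ m →
      br (x k) e = (-(k : ℂ) * ((m : ℂ) + 1 - (k : ℂ))) • x (k - 1))
    (hx0e : br (x 0) e = 0)
    (hzx : ∀ z : L, ∀ k ≤ m, br z (x k) = 0)
    (y₁ y₂ : L)
    (hey1 : br e y₁ = 0) (hfy1 : br f y₁ = 0) (hhy1 : br h y₁ = 0)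
    (hey2 : br e y₂ = 0) (hfy2 : br f y₂ = 0) (hhy2 : br h y₂ = 0)
    (hy1e : br y₁ e ∈ Submodule.span ℂ (x '' {k | k ≤ m}))
    (hy1f : br y₁ f ∈ Submodule.span ℂ (x '' {k | k ≤ m}))
    (hy1h : br y₁ h ∈ Submodule.span ℂ (x '' {k | k ≤ m}))
    (hy1y1 : br y₁ y₁ ∈ Submodule.span ℂ (x '' {k | k ≤ m}))
    (hy2e : br y₂ e ∈ Submodule.span ℂ (x '' {k | k ≤ m}))
    (hy2f : br y₂ f ∈ Submodule.span ℂ (x '' {k | k ≤ m}))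
    (hy2h : br y₂ h ∈ Submodule.span ℂ (x '' {k | k ≤ m}))
    (hy2y2 : br y₂ y₂ ∈ Submodule.span ℂ (x '' {k | k ≤ m}))
    (hxy1 : ∀ k ≤ m, br (x k) y₁ ∈ Submodule.span ℂ (x '' {k | k ≤ m}))
    (hxy2 : ∀ k ≤ m, br (x k) y₂ ∈ Submodule.span ℂ (x '' {k | k ≤ m}))
    (hy12 : br y₁ y₂ - y₁ ∈ Submodule.span ℂ (x '' {k | k ≤ m}))
    (hy21 : br y₂ y₁ = -y₁)
    :
    ∃ a : ℂ, ∀ k ≤ m, br (x k) y₂ = a • x k := by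
  have hli : LinearIndependent ℂ (fun i : Fin (m + 1) => x i) := by
    have := hind.comp (fun i : Fin (m + 1) => i.succ.succ.succ)
      (fun a b hab => by simpa using hab)
    exact this
  have hset : x '' {k | k ≤ m} = Set.range (fun i : Fin (m + 1) => x i) := by
    ext z
    constructor
    · rintro ⟨k, hk, rfl⟩
      exact ⟨⟨k, Nat.lt_succ_of_le hk⟩, rfl⟩
    · rintro ⟨i, rfl⟩
      exact ⟨i, Nat.le_of_lt_succ i.2, rfl⟩
  have hch : ∀ z, br (br z h) y₂ = br (br z y₂) h := fun z => by
    have := leib z h y₂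
    rw [hhy2, map_zero] at this
    exact (sub_eq_zero.mp this.symm)
  have hcf : ∀ z, br (br z f) y₂ = br (br z y₂) f := fun z => by
    have := leib z f y₂
    rw [hfy2, map_zero] at this
    exact (sub_eq_zero.mp this.symm)
  have h0 := hxy2 0 (Nat.zero_le m)
  rw [hset, Submodule.mem_span_range_iff_exists_fun] at h0
  obtain ⟨c, hc⟩ := h0
  have h1 := hch (x 0)
  rw [hxh 0 (Nat.zero_le m), map_smul, LinearMap.smul_apply, ← hc, map_sum,
    LinearMap.sum_apply, Finset.smul_sum] at h1
  have h2 : ∑ i : Fin (m + 1), (2 * (i : ℕ) * c i : ℂ) • x i = 0 := by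
    rw [← sub_eq_zero, ← Finset.sum_sub_distrib] at h1
    rw [← h1]
    refine Finset.sum_congr rfl fun i _ => ?_
    rw [map_smul, LinearMap.smul_apply, hxh i (Nat.le_of_lt_succ i.2), smul_smul, smul_smul,
      ← sub_smul]
    congr 1
    push_cast
    ring
  have h3 := Fintype.linearIndependent_iff.mp hli _ h2
  refine ⟨c 0, fun k => ?_⟩
  induction k with
  | zero =>
    intro _
    rw [← hc, Finset.sum_eq_single 0]
    · simp
    · intro i _ hi
      have hi' : ((i : ℕ) : ℂ) ≠ 0 := by
        exact Nat.cast_ne_zero.mpr fun hz => hi (Fin.ext hz)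
      have : c i = 0 := by simpa [hi, hi'] using h3 i
      rw [this, zero_smul]
    · simp
  | succ k ih =>
    intro hk
    rw [← hxf k hk, hcf, ih (Nat.le_of_lt hk), map_smul, LinearMap.smul_apply]
end

section
/- Under these hypotheses, [y₁,y₁] = 0, [y₁,e] = [y₁,f] = [y₁,h] = 0, and [y₁,y₂] = y₁. -/
/-- Under the hypotheses of the main theorem (together with `[I,y₁] = 0` and `[x_k,y₂] = a•x_k`), `[y₁,y₁] = 0`, `[y₁,e] = [y₁,f] = [y₁,h] = 0` and `[y₁,y₂] = y₁`. -/
theorem y1_brackets_vanish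
    (L : Type*) [AddCommGroup L] [Module ℂ L]
    (br : L →ₗ[ℂ] L →ₗ[ℂ] L)
    (leib : ∀ x y z : L, br x (br y z) = br (br x y) z - br (br x z) y)
    (m : ℕ) (hm : 1 ≤ m)
    (e h f : L) (x : ℕ → L)
    (hind : LinearIndependent ℂ
      (Fin.cons e (Fin.cons h (Fin.cons f (fun i : Fin (m + 1) => x i)))))
    (heh : br e h = (2 : ℂ) • e) (hhf : br h f = (2 : ℂ) • f) (hef : br e f = h)
    (hhe : br h e = (-2 : ℂ) • e) (hfh : br f h = (-2 : ℂ) • f) (hfe : br f e = -h)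
    (hee : br e e = 0) (hff : br f f = 0) (hhh : br h h = 0)
    (hxh : ∀ k ≤ m, br (x k) h = ((m : ℂ) - 2 * k) • x k)
    (hxf : ∀ k < m, br (x k) f = x (k + 1)) (hxmf : br (x m) f = 0)
    (hxe : ∀ k, 1 ≤ k → k ≤ m →
      br (x k) e = (-(k : ℂ) * ((m : ℂ) + 1 - (k : ℂ))) • x (k - 1))
    (hx0e : br (x 0) e = 0)
    (hzx : ∀ z : L, ∀ k ≤ m, br z (x k) = 0)
    (y₁ y₂ : L)
    (hey1 : br e y₁ = 0) (hfy1 : br f y₁ = 0) (hhy1 : br h y₁ = 0)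
    (hey2 : br e y₂ = 0) (hfy2 : br f y₂ = 0) (hhy2 : br h y₂ = 0)
    (hy1e : br y₁ e ∈ Submodule.span ℂ (x '' {k | k ≤ m}))
    (hy1f : br y₁ f ∈ Submodule.span ℂ (x '' {k | k ≤ m}))
    (hy1h : br y₁ h ∈ Submodule.span ℂ (x '' {k | k ≤ m}))
    (hy1y1 : br y₁ y₁ ∈ Submodule.span ℂ (x '' {k | k ≤ m}))
    (hy2e : br y₂ e ∈ Submodule.span ℂ (x '' {k | k ≤ m}))
    (hy2f : br y₂ f ∈ Submodule.span ℂ (x '' {k | k ≤ m}))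
    (hy2h : br y₂ h ∈ Submodule.span ℂ (x '' {k | k ≤ m}))
    (hy2y2 : br y₂ y₂ ∈ Submodule.span ℂ (x '' {k | k ≤ m}))
    (hxy1 : ∀ k ≤ m, br (x k) y₁ ∈ Submodule.span ℂ (x '' {k | k ≤ m}))
    (hxy2 : ∀ k ≤ m, br (x k) y₂ ∈ Submodule.span ℂ (x '' {k | k ≤ m}))
    (hy12 : br y₁ y₂ - y₁ ∈ Submodule.span ℂ (x '' {k | k ≤ m}))
    (hy21 : br y₂ y₁ = -y₁)
    (hxy1z : ∀ k ≤ m, br (x k) y₁ = 0)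
    (a : ℂ) (hxy2a : ∀ k ≤ m, br (x k) y₂ = a • x k)
    :
    br y₁ y₁ = 0 ∧ br y₁ e = 0 ∧ br y₁ f = 0 ∧ br y₁ h = 0 ∧ br y₁ y₂ = y₁ := by
  have key : ∀ v ∈ Submodule.span ℂ (x '' {k | k ≤ m}),
      br (br v h) h - (2 : ℂ) • (br (br v e) f + br (br v f) e)
        = ((m : ℂ) * (m + 2)) • v := by
    intro v hv
    induction hv using Submodule.span_induction with
    | mem v hv =>
      obtain ⟨k, hk, rfl⟩ := hv
      have hk : k ≤ m := hk
      have h1 : br (br (x k) h) h = (((m : ℂ) - 2 * k) * ((m : ℂ) - 2 * k)) • x k := by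
        rw [hxh k hk, map_smul, LinearMap.smul_apply, hxh k hk, smul_smul]
      have h2 : br (br (x k) e) f = (-(k : ℂ) * ((m : ℂ) + 1 - (k : ℂ))) • x k := by
        rcases Nat.eq_zero_or_pos k with h0 | h0
        · subst h0
          simp [hx0e]
        · rw [hxe k h0 hk, map_smul, LinearMap.smul_apply, hxf (k - 1) (by omega),
            Nat.sub_add_cancel h0]
      have h3 : br (br (x k) f) e = (-((k : ℂ) + 1) * ((m : ℂ) - (k : ℂ))) • x k := by
        rcases Nat.lt_or_ge k m with h0 | h0
        · rw [hxf k h0, hxe (k + 1) (by omega) (by omega)]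
          rw [Nat.add_sub_cancel]
          push_cast
          congr 1
          ring
        · have : k = m := le_antisymm hk h0
          subst this
          simp [hxmf]
      rw [h1, h2, h3]
      module
    | zero => simp
    | add u v _ _ hu hv =>
      simp only [map_add, LinearMap.add_apply, smul_add] at *
      rw [← hu, ← hv]
      abel
    | smul c v _ hv =>
      simp only [map_smul, LinearMap.smul_apply]
      rw [smul_comm _ c v, ← hv]
      module
  have inv : ∀ v ∈ Submodule.span ℂ (x '' {k | k ≤ m}),
      br v e = 0 → br v f = 0 → br v h = 0 → v = 0 := by
    intro v hv he hf hh
    have := key v hv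
    simp only [he, hf, hh, map_zero, LinearMap.zero_apply, add_zero, smul_zero, sub_zero] at this
    rcases smul_eq_zero.1 this.symm with h0 | h0
    · exfalso
      have : m * (m + 2) = 0 := by exact_mod_cast h0
      have : 0 < m * (m + 2) := by positivity
      omega
    · exact h0
  have zI : ∀ z, ∀ v ∈ Submodule.span ℂ (x '' {k | k ≤ m}), br z v = 0 := by
    intro z v hv
    have : Submodule.span ℂ (x '' {k | k ≤ m}) ≤ LinearMap.ker (br z) := by
      rw [Submodule.span_le]
      rintro _ ⟨k, hk, rfl⟩
      exact hzx z k hk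
    exact this hv
  have Iy : ∀ v ∈ Submodule.span ℂ (x '' {k | k ≤ m}), br v y₁ = 0 := by
    intro v hv
    have : Submodule.span ℂ (x '' {k | k ≤ m}) ≤ LinearMap.ker (br.flip y₁) := by
      rw [Submodule.span_le]
      rintro _ ⟨k, hk, rfl⟩
      exact hxy1z k hk
    exact this hv
  have step : ∀ s, br s y₁ = 0 → br y₂ s ∈ Submodule.span ℂ (x '' {k | k ≤ m}) →
      br y₁ s = 0 := by
    intro s hs h2
    have := leib y₂ s y₁
    rw [hs, Iy _ h2, hy21] at this
    simpa using this.symm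
  have He := step e hey1 hy2e
  have Hf := step f hfy1 hy2f
  have Hh := step h hhy1 hy2h
  have A : ∀ s, br y₁ s = 0 → br (br y₁ y₁) s = 0 := by
    intro s hs
    have := leib y₁ y₁ s
    rw [hs] at this
    simpa using this.symm
  have B : ∀ s, br y₁ s = 0 → br y₂ s ∈ Submodule.span ℂ (x '' {k | k ≤ m}) →
      br (br y₁ y₂ - y₁) s = 0 := by
    intro s hs h2
    have := leib y₁ y₂ s
    rw [hs, zI _ _ h2] at this
    simpa [hs] using this.symm
  exact ⟨inv _ hy1y1 (A e He) (A f Hf) (A h Hh), He, Hf, Hh,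
    sub_eq_zero.1 (inv _ hy12 (B e He hy2e) (B f Hf hy2f) (B h Hh hy2h))⟩
end

section
/- Assume additionally a ≠ 0, [y₁,y₁] = 0, [y₁,e] = [y₁,f] = [y₁,h] = 0 and [y₁,y₂] = y₁. Then there exists y₂' ∈ L with y₂' − y₂ ∈ I such that [y₂',y₂'] = 0, [y₂',e] = [y₂',f] = [y₂',h] = 0, [x_k,y₂'] = a·x_k for all 0 ≤ k ≤ m, [y₁,y₂'] = y₁, and [y₂',y₁] = −y₁. -/
/-- Case 1, `a ≠ 0`: there exists `y₂′ ∈ L` with `y₂′ - y₂ ∈ I` such that `[y₂′,y₂′] = 0`, `[y₂′,e] = [y₂′,f] = [y₂′,h] = 0`, `[x_k,y₂′] = a•x_k`, `[y₁,y₂′] = y₁` and `[y₂′,y₁] = -y₁`. -/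
theorem case_a_ne_zero
    (L : Type*) [AddCommGroup L] [Module ℂ L]
    (br : L →ₗ[ℂ] L →ₗ[ℂ] L)
    (leib : ∀ x y z : L, br x (br y z) = br (br x y) z - br (br x z) y)
    (m : ℕ) (hm : 1 ≤ m)
    (e h f : L) (x : ℕ → L)
    (hind : LinearIndependent ℂ
      (Fin.cons e (Fin.cons h (Fin.cons f (fun i : Fin (m + 1) => x i)))))
    (heh : br e h = (2 : ℂ) • e) (hhf : br h f = (2 : ℂ) • f) (hef : br e f = h)
    (hhe : br h e = (-2 : ℂ) • e) (hfh : br f h = (-2 : ℂ) • f) (hfe : br f e = -h)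
    (hee : br e e = 0) (hff : br f f = 0) (hhh : br h h = 0)
    (hxh : ∀ k ≤ m, br (x k) h = ((m : ℂ) - 2 * k) • x k)
    (hxf : ∀ k < m, br (x k) f = x (k + 1)) (hxmf : br (x m) f = 0)
    (hxe : ∀ k, 1 ≤ k → k ≤ m →
      br (x k) e = (-(k : ℂ) * ((m : ℂ) + 1 - (k : ℂ))) • x (k - 1))
    (hx0e : br (x 0) e = 0)
    (hzx : ∀ z : L, ∀ k ≤ m, br z (x k) = 0)
    (y₁ y₂ : L)
    (hey1 : br e y₁ = 0) (hfy1 : br f y₁ = 0) (hhy1 : br h y₁ = 0)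
    (hey2 : br e y₂ = 0) (hfy2 : br f y₂ = 0) (hhy2 : br h y₂ = 0)
    (hy1e : br y₁ e ∈ Submodule.span ℂ (x '' {k | k ≤ m}))
    (hy1f : br y₁ f ∈ Submodule.span ℂ (x '' {k | k ≤ m}))
    (hy1h : br y₁ h ∈ Submodule.span ℂ (x '' {k | k ≤ m}))
    (hy1y1 : br y₁ y₁ ∈ Submodule.span ℂ (x '' {k | k ≤ m}))
    (hy2e : br y₂ e ∈ Submodule.span ℂ (x '' {k | k ≤ m}))
    (hy2f : br y₂ f ∈ Submodule.span ℂ (x '' {k | k ≤ m}))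
    (hy2h : br y₂ h ∈ Submodule.span ℂ (x '' {k | k ≤ m}))
    (hy2y2 : br y₂ y₂ ∈ Submodule.span ℂ (x '' {k | k ≤ m}))
    (hxy1 : ∀ k ≤ m, br (x k) y₁ ∈ Submodule.span ℂ (x '' {k | k ≤ m}))
    (hxy2 : ∀ k ≤ m, br (x k) y₂ ∈ Submodule.span ℂ (x '' {k | k ≤ m}))
    (hy12 : br y₁ y₂ - y₁ ∈ Submodule.span ℂ (x '' {k | k ≤ m}))
    (hy21 : br y₂ y₁ = -y₁)
    (hxy1z : ∀ k ≤ m, br (x k) y₁ = 0)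
    (a : ℂ) (hxy2a : ∀ k ≤ m, br (x k) y₂ = a • x k)
    (ha : a ≠ 0)
    (hy1y1z : br y₁ y₁ = 0) (hy1ez : br y₁ e = 0) (hy1fz : br y₁ f = 0)
    (hy1hz : br y₁ h = 0) (hy12e : br y₁ y₂ = y₁)
    :
    ∃ y₂' : L, y₂' - y₂ ∈ Submodule.span ℂ (x '' {k | k ≤ m}) ∧
      br y₂' y₂' = 0 ∧ br y₂' e = 0 ∧ br y₂' f = 0 ∧ br y₂' h = 0 ∧
      (∀ k ≤ m, br (x k) y₂' = a • x k) ∧ br y₁ y₂' = y₁ ∧ br y₂' y₁ = -y₁ := by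
  set I := Submodule.span ℂ (x '' {k | k ≤ m}) with hI
  have hxI : ∀ k ≤ m, x k ∈ I := fun k hk => Submodule.subset_span ⟨k, hk, rfl⟩
  have zI : ∀ z : L, ∀ v ∈ I, br z v = 0 := by
    intro z v hv
    have : I ≤ LinearMap.ker (br z) := by
      rw [hI, Submodule.span_le]
      rintro _ ⟨k, hk, rfl⟩
      exact hzx z k hk
    exact this hv
  have I1 : ∀ v ∈ I, br v y₁ = 0 := by
    intro v hv
    have : I ≤ LinearMap.ker (br.flip y₁) := by
      rw [hI, Submodule.span_le]
      rintro _ ⟨k, hk, rfl⟩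
      exact hxy1z k hk
    exact this hv
  have I2 : ∀ v ∈ I, br v y₂ = a • v := by
    intro v hv
    have : I ≤ LinearMap.ker (br.flip y₂ - a • LinearMap.id) := by
      rw [hI, Submodule.span_le]
      rintro _ ⟨k, hk, rfl⟩
      simp [hxy2a k hk]
    have := this hv
    simpa [sub_eq_zero] using this
  have stab : ∀ s : L, (∀ k ≤ m, br (x k) s ∈ I) → ∀ v ∈ I, br v s ∈ I := by
    intro s hs v hv
    have : I ≤ I.comap (br.flip s) := by
      conv_lhs => rw [hI]
      rw [Submodule.span_le]
      rintro _ ⟨k, hk, rfl⟩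
      exact hs k hk
    exact this hv
  have Se : ∀ v ∈ I, br v e ∈ I := by
    apply stab
    intro k hk
    rcases Nat.eq_zero_or_pos k with rfl | h0
    · rw [hx0e]; exact I.zero_mem
    · rw [hxe k h0 hk]; exact I.smul_mem _ (hxI _ (by omega))
  have Sf : ∀ v ∈ I, br v f ∈ I := by
    apply stab
    intro k hk
    rcases hk.eq_or_lt with rfl | h0
    · rw [hxmf]; exact I.zero_mem
    · rw [hxf k h0]; exact hxI _ h0
  have Sh : ∀ v ∈ I, br v h ∈ I := by
    apply stab
    intro k hk
    rw [hxh k hk]; exact I.smul_mem _ (hxI _ hk)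
  have huI : a⁻¹ • br y₂ y₂ ∈ I := I.smul_mem _ hy2y2
  have hu2 : br (a⁻¹ • br y₂ y₂) y₂ = br y₂ y₂ := by
    rw [I2 _ huI, smul_smul, mul_inv_cancel₀ ha, one_smul]
  generalize a⁻¹ • br y₂ y₂ = u at huI hu2
  have h2 : br (y₂ - u) y₂ = 0 := by
    rw [map_sub, LinearMap.sub_apply, hu2, sub_self]
  have key : ∀ s : L, br s y₂ = 0 → br y₂ s ∈ I → (∀ v ∈ I, br v s ∈ I) →
      br (y₂ - u) s = 0 := by
    intro s hs hm' hst
    have hmem : br (y₂ - u) s ∈ I := by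
      rw [map_sub, LinearMap.sub_apply]
      exact I.sub_mem hm' (hst u huI)
    have hl := leib (y₂ - u) s y₂
    rw [hs, h2, I2 _ hmem, map_zero, map_zero, LinearMap.zero_apply, sub_zero] at hl
    exact (smul_eq_zero.mp hl.symm).resolve_left ha
  refine ⟨y₂ - u, ?_, ?_, key e hey2 hy2e Se, key f hfy2 hy2f Sf, key h hhy2 hy2h Sh, ?_, ?_, ?_⟩
  · rw [sub_sub_cancel_left]; exact I.neg_mem huI
  · rw [map_sub (br (y₂ - u)), h2, zI _ u huI, sub_zero]
  · intro k hk
    rw [map_sub, zI _ u huI, sub_zero, hxy2a k hk]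
  · rw [map_sub, zI _ u huI, sub_zero, hy12e]
  · rw [map_sub, LinearMap.sub_apply, I1 u huI, sub_zero, hy21]
end

section
/- Assume additionally a = 0 (i.e., [x_k,y₂] = 0 for all k), [y₁,y₁] = 0, [y₁,e] = [y₁,f] = [y₁,h] = 0 and [y₁,y₂] = y₁. Then [y₂,y₂] = 0, and there exists y₂' ∈ L with y₂' − y₂ ∈ I such that [y₂',e] = [y₂',f] = [y₂',h] = 0, [y₂',y₂'] = 0, [x_k,y₂'] = 0 for all 0 ≤ k ≤ m, [y₁,y₂'] = y₁, and [y₂',y₁] = −y₁. -/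
/-- Case 2, `a = 0`: `[y₂,y₂] = 0`, and there exists `y₂′ ∈ L` with `y₂′ - y₂ ∈ I` such that `[y₂′,e] = [y₂′,f] = [y₂′,h] = 0`, `[y₂′,y₂′] = 0`, `[x_k,y₂′] = 0`, `[y₁,y₂′] = y₁` and `[y₂′,y₁] = -y₁`. -/
theorem case_a_eq_zero
    (L : Type*) [AddCommGroup L] [Module ℂ L]
    (br : L →ₗ[ℂ] L →ₗ[ℂ] L)
    (leib : ∀ x y z : L, br x (br y z) = br (br x y) z - br (br x z) y)
    (m : ℕ) (hm : 1 ≤ m)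
    (e h f : L) (x : ℕ → L)
    (hind : LinearIndependent ℂ
      (Fin.cons e (Fin.cons h (Fin.cons f (fun i : Fin (m + 1) => x i)))))
    (heh : br e h = (2 : ℂ) • e) (hhf : br h f = (2 : ℂ) • f) (hef : br e f = h)
    (hhe : br h e = (-2 : ℂ) • e) (hfh : br f h = (-2 : ℂ) • f) (hfe : br f e = -h)
    (hee : br e e = 0) (hff : br f f = 0) (hhh : br h h = 0)
    (hxh : ∀ k ≤ m, br (x k) h = ((m : ℂ) - 2 * k) • x k)
    (hxf : ∀ k < m, br (x k) f = x (k + 1)) (hxmf : br (x m) f = 0)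
    (hxe : ∀ k, 1 ≤ k → k ≤ m →
      br (x k) e = (-(k : ℂ) * ((m : ℂ) + 1 - (k : ℂ))) • x (k - 1))
    (hx0e : br (x 0) e = 0)
    (hzx : ∀ z : L, ∀ k ≤ m, br z (x k) = 0)
    (y₁ y₂ : L)
    (hey1 : br e y₁ = 0) (hfy1 : br f y₁ = 0) (hhy1 : br h y₁ = 0)
    (hey2 : br e y₂ = 0) (hfy2 : br f y₂ = 0) (hhy2 : br h y₂ = 0)
    (hy1e : br y₁ e ∈ Submodule.span ℂ (x '' {k | k ≤ m}))
    (hy1f : br y₁ f ∈ Submodule.span ℂ (x '' {k | k ≤ m}))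
    (hy1h : br y₁ h ∈ Submodule.span ℂ (x '' {k | k ≤ m}))
    (hy1y1 : br y₁ y₁ ∈ Submodule.span ℂ (x '' {k | k ≤ m}))
    (hy2e : br y₂ e ∈ Submodule.span ℂ (x '' {k | k ≤ m}))
    (hy2f : br y₂ f ∈ Submodule.span ℂ (x '' {k | k ≤ m}))
    (hy2h : br y₂ h ∈ Submodule.span ℂ (x '' {k | k ≤ m}))
    (hy2y2 : br y₂ y₂ ∈ Submodule.span ℂ (x '' {k | k ≤ m}))
    (hxy1 : ∀ k ≤ m, br (x k) y₁ ∈ Submodule.span ℂ (x '' {k | k ≤ m}))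
    (hxy2 : ∀ k ≤ m, br (x k) y₂ ∈ Submodule.span ℂ (x '' {k | k ≤ m}))
    (hy12 : br y₁ y₂ - y₁ ∈ Submodule.span ℂ (x '' {k | k ≤ m}))
    (hy21 : br y₂ y₁ = -y₁)
    (hxy1z : ∀ k ≤ m, br (x k) y₁ = 0)
    (hxy2z : ∀ k ≤ m, br (x k) y₂ = 0)
    (hy1y1z : br y₁ y₁ = 0) (hy1ez : br y₁ e = 0) (hy1fz : br y₁ f = 0)
    (hy1hz : br y₁ h = 0) (hy12e : br y₁ y₂ = y₁)
    :
    br y₂ y₂ = 0 ∧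
    ∃ y₂' : L, y₂' - y₂ ∈ Submodule.span ℂ (x '' {k | k ≤ m}) ∧
      br y₂' e = 0 ∧ br y₂' f = 0 ∧ br y₂' h = 0 ∧ br y₂' y₂' = 0 ∧
      (∀ k ≤ m, br (x k) y₂' = 0) ∧ br y₁ y₂' = y₁ ∧ br y₂' y₁ = -y₁ := by
  set I := Submodule.span ℂ (x '' {k | k ≤ m}) with hI
  have hxI : ∀ k ≤ m, x k ∈ I := fun k hk => Submodule.subset_span ⟨k, hk, rfl⟩
  have key : ∀ T : L →ₗ[ℂ] L, (∀ k ≤ m, T (x k) = 0) → ∀ v ∈ I, T v = 0 := by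
    intro T hT v hv
    have : I ≤ LinearMap.ker T := by
      rw [hI, Submodule.span_le]
      rintro _ ⟨k, hk, rfl⟩
      exact hT k hk
    exact this hv
  have key2 : ∀ T : L →ₗ[ℂ] L, (∀ k ≤ m, T (x k) ∈ I) → ∀ v ∈ I, T v ∈ I := by
    intro T hT v hv
    have : I ≤ I.comap T := by
      conv_lhs => rw [hI]
      rw [Submodule.span_le]
      rintro _ ⟨k, hk, rfl⟩
      exact hT k hk
    exact this hv
  have zI : ∀ z, ∀ v ∈ I, br z v = 0 := fun z => key (br z) (hzx z)
  have I1 : ∀ v ∈ I, br v y₁ = 0 := key (br.flip y₁) hxy1z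
  have I2 : ∀ v ∈ I, br v y₂ = 0 := key (br.flip y₂) hxy2z
  have Ie : ∀ v ∈ I, br v e ∈ I := by
    refine key2 (br.flip e) fun k hk => ?_
    rcases Nat.eq_zero_or_pos k with rfl | h0
    · simp [hx0e]
    · simp only [LinearMap.flip_apply]
      rw [hxe k h0 hk]
      exact I.smul_mem _ (hxI _ (by omega))
  have If : ∀ v ∈ I, br v f ∈ I := by
    refine key2 (br.flip f) fun k hk => ?_
    rcases Nat.eq_or_lt_of_le hk with rfl | h0
    · simp [hxmf]
    · simp only [LinearMap.flip_apply]
      rw [hxf k h0]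
      exact hxI _ h0
  have Ih : ∀ v ∈ I, br v h ∈ I := by
    refine key2 (br.flip h) fun k hk => ?_
    simp only [LinearMap.flip_apply]
    rw [hxh k hk]
    exact I.smul_mem _ (hxI _ hk)
  set c : ℂ := (m : ℂ) + (m : ℂ) ^ 2 / 2 with hc
  have hc0 : c ≠ 0 := by
    have h1 : (0 : ℝ) < (m : ℝ) + (m : ℝ) ^ 2 / 2 := by
      have : (0 : ℝ) < m := by exact_mod_cast hm
      positivity
    have h2 : c = (((m : ℝ) + (m : ℝ) ^ 2 / 2 : ℝ) : ℂ) := by rw [hc]; push_cast; ring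
    rw [h2]
    exact_mod_cast (ne_of_gt h1)
  have cas : ∀ v ∈ I, -(br (br v e) f) - br (br v f) e + (1 / 2 : ℂ) • br (br v h) h = c • v := by
    intro v hv
    have := key (-((br.flip f) ∘ₗ (br.flip e)) - (br.flip e) ∘ₗ (br.flip f)
      + (1 / 2 : ℂ) • ((br.flip h) ∘ₗ (br.flip h)) - c • LinearMap.id) ?_ v hv
    · simpa [sub_eq_zero] using this
    · intro k hk
      have hEF : br (br (x k) e) f = (-(k : ℂ) * ((m : ℂ) + 1 - (k : ℂ))) • x k := by
        rcases Nat.eq_zero_or_pos k with rfl | h0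
        · simp [hx0e]
        · rw [hxe k h0 hk, map_smul, LinearMap.smul_apply, hxf (k - 1) (by omega),
            Nat.sub_add_cancel h0]
      have hFE : br (br (x k) f) e = (-((k : ℂ) + 1) * ((m : ℂ) - (k : ℂ))) • x k := by
        rcases Nat.eq_or_lt_of_le hk with rfl | h0
        · simp [hxmf]
        · rw [hxf k h0, hxe (k + 1) (by omega) h0, Nat.add_sub_cancel]
          congr 1
          push_cast
          ring
      have hHH : br (br (x k) h) h = (((m : ℂ) - 2 * k) * ((m : ℂ) - 2 * k)) • x k := by
        rw [hxh k hk, map_smul, LinearMap.smul_apply, hxh k hk, smul_smul]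
      simp only [LinearMap.sub_apply, LinearMap.add_apply, LinearMap.neg_apply,
        LinearMap.smul_apply, LinearMap.comp_apply, LinearMap.flip_apply, LinearMap.id_apply]
      rw [hEF, hFE, hHH, hc]
      module
  have te : br (br y₂ y₂) e = 0 := by
    have := leib y₂ y₂ e
    rw [zI _ _ hy2e, I2 _ hy2e, sub_zero] at this
    exact this.symm
  have tf : br (br y₂ y₂) f = 0 := by
    have := leib y₂ y₂ f
    rw [zI _ _ hy2f, I2 _ hy2f, sub_zero] at this
    exact this.symm
  have th : br (br y₂ y₂) h = 0 := by
    have := leib y₂ y₂ h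
    rw [zI _ _ hy2h, I2 _ hy2h, sub_zero] at this
    exact this.symm
  have t0 : br y₂ y₂ = 0 := by
    have := cas _ hy2y2
    rw [te, tf, th] at this
    simp only [map_zero, LinearMap.zero_apply, smul_zero, neg_zero, sub_zero, add_zero] at this
    exact (smul_eq_zero.mp this.symm).resolve_left hc0
  refine ⟨t0, ?_⟩
  have mh : ∀ v, br v h = br (br v e) f - br (br v f) e := fun v => by
    rw [← leib, hef]
  have me : ∀ v, (2 : ℂ) • br v e = br (br v e) h - br (br v h) e := fun v => by
    rw [← leib, heh, map_smul]
  have mf : ∀ v, (2 : ℂ) • br v f = br (br v h) f - br (br v f) h := fun v => by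
    rw [← leib, hhf, map_smul]
  obtain ⟨p, hp⟩ : ∃ p, p = br y₂ e := ⟨_, rfl⟩
  obtain ⟨q, hq⟩ : ∃ q, q = br y₂ f := ⟨_, rfl⟩
  obtain ⟨r, hr⟩ : ∃ r, r = br y₂ h := ⟨_, rfl⟩
  have ch := mh y₂
  have ce := me y₂
  have cf := mf y₂
  rw [← hp] at hy2e
  rw [← hq] at hy2f
  rw [← hr] at hy2h
  rw [← hp, ← hq, ← hr] at ch
  rw [← hp, ← hr] at ce
  rw [← hq, ← hr] at cf
  obtain ⟨w, hw⟩ : ∃ w, w = -(br p f) - br q e + (1 / 2 : ℂ) • br r h := ⟨_, rfl⟩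
  have wI : w ∈ I := by
    rw [hw]
    exact I.add_mem (I.sub_mem (I.neg_mem (If _ hy2e)) (Ie _ hy2f)) (I.smul_mem _ (Ih _ hy2h))
  have we : br w e = c • p := by
    rw [← cas p hy2e, hw]
    have a1 := congrArg (fun v => br v e) ch
    have a2 := congrArg (fun v => br v h) ce
    simp only [map_sub, map_smul, LinearMap.sub_apply, LinearMap.smul_apply] at a1 a2
    simp only [map_sub, map_add, map_neg, map_smul, LinearMap.sub_apply, LinearMap.add_apply,
      LinearMap.neg_apply, LinearMap.smul_apply]
    have a3 := mh p
    have a4 := me r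
    linear_combination (norm := module) (-1 : ℂ) • a1 + (1 / 2 : ℂ) • a2 - a3 + (1 / 2 : ℂ) • a4
  have wf : br w f = c • q := by
    rw [← cas q hy2f, hw]
    have a1 := congrArg (fun v => br v f) ch
    have a2 := congrArg (fun v => br v h) cf
    simp only [map_sub, map_smul, LinearMap.sub_apply, LinearMap.smul_apply] at a1 a2
    simp only [map_sub, map_add, map_neg, map_smul, LinearMap.sub_apply, LinearMap.add_apply,
      LinearMap.neg_apply, LinearMap.smul_apply]
    have a3 := mh q
    have a4 := mf r
    linear_combination (norm := module) a1 - (1 / 2 : ℂ) • a2 + a3 - (1 / 2 : ℂ) • a4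
  have wh : br w h = c • r := by
    rw [mh w, we, wf, ch]
    simp only [map_smul, LinearMap.smul_apply, smul_sub]
  have uI : c⁻¹ • w ∈ I := I.smul_mem _ wI
  have ue : br (c⁻¹ • w) e = p := by
    rw [map_smul, LinearMap.smul_apply, we, inv_smul_smul₀ hc0]
  have uf : br (c⁻¹ • w) f = q := by
    rw [map_smul, LinearMap.smul_apply, wf, inv_smul_smul₀ hc0]
  have uh : br (c⁻¹ • w) h = r := by
    rw [map_smul, LinearMap.smul_apply, wh, inv_smul_smul₀ hc0]
  generalize c⁻¹ • w = u at uI ue uf uh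
  refine ⟨y₂ - u, ?_, ?_, ?_, ?_, ?_, ?_, ?_, ?_⟩
  · rw [sub_sub_cancel_left]
    exact I.neg_mem uI
  · rw [map_sub, LinearMap.sub_apply, ue, hp, sub_self]
  · rw [map_sub, LinearMap.sub_apply, uf, hq, sub_self]
  · rw [map_sub, LinearMap.sub_apply, uh, hr, sub_self]
  · rw [map_sub (br (y₂ - u)), zI _ _ uI, map_sub, LinearMap.sub_apply, t0, I2 _ uI]
    simp
  · intro k hk
    rw [map_sub, zI _ _ uI, hxy2z k hk, sub_zero]
  · rw [map_sub, zI _ _ uI, hy12e, sub_zero]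
  · rw [map_sub, LinearMap.sub_apply, I1 _ uI, hy21, sub_zero]
end

section
/- Assume m ≠ 2. Then there exist a ∈ ℂ and an element y₂' ∈ L with y₂' − y₂ ∈ I such that {e, h, f, x_0, …, x_m, y₁, y₂'} is a basis of L in which the only nonzero brackets among basis vectors are: [e,h] = 2e, [h,f] = 2f, [e,f] = h, [h,e] = −2e, [f,h] = −2f, [f,e] = −h, [x_k,h] = (m−2k)x_k (0 ≤ k ≤ m), [x_k,f] = x_{k+1} (0 ≤ k ≤ m−1), [x_k,e] = −k(m+1−k)x_{k−1} (1 ≤ k ≤ m), [y₁,y₂'] = y₁, [y₂',y₁] = −y₁, and [x_k,y₂'] = a·x_k (0 ≤ k ≤ m). (This is the paper's first main theorem; the paper writes the dimension restriction as m ≠ 3, the excluded case being dim I = 3, i.e., m = 2.) -/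
theorem aux_range {L : Type*} (m : ℕ) (e h f : L) (x : ℕ → L) (y z : L) :
    Set.range (Fin.cons e (Fin.cons h (Fin.cons f
        (Fin.snoc (Fin.snoc (fun i : Fin (m + 1) => x i) y) z))) : Fin (m+1+1+1+1+1+1) → L)
      = insert e (insert h (insert f (insert z (insert y (x '' {k | k ≤ m}))))) := by
  have h1 : ∀ (n : ℕ) (g : Fin n → L) (a : L),
      Set.range (Fin.snoc g a : Fin (n+1) → L) = insert a (Set.range g) := by
    intro n g a
    ext t
    constructor
    · rintro ⟨i, rfl⟩
      induction i using Fin.lastCases with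
      | last => left; simp
      | cast i => right; exact ⟨i, by simp⟩
    · rintro (rfl | ⟨i, rfl⟩)
      · exact ⟨Fin.last n, by simp⟩
      · exact ⟨i.castSucc, by simp⟩
  have h2 : Set.range (fun i : Fin (m + 1) => x i) = x '' {k | k ≤ m} := by
    ext t
    constructor
    · rintro ⟨i, rfl⟩
      exact ⟨i, Nat.lt_succ_iff.mp i.2, rfl⟩
    · rintro ⟨k, hk, rfl⟩
      exact ⟨⟨k, Nat.lt_succ_iff.mpr hk⟩, rfl⟩
  rw [Fin.range_cons, Fin.range_cons, Fin.range_cons, h1, h1, h2]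

theorem aux_indep {L : Type*} [AddCommGroup L] [Module ℂ L]
    (m : ℕ) (e h f : L) (x : ℕ → L) (y z : L)
    (hind : LinearIndependent ℂ
      (Fin.cons e (Fin.cons h (Fin.cons f
        (Fin.snoc (Fin.snoc (fun i : Fin (m + 1) => x i) y) z))) :
          Fin (m+1+1+1+1+1+1) → L)) :
    LinearIndependent ℂ (fun i : Fin (m + 1) => x i) := by
  have := hind.comp (fun i : Fin (m+1) => i.castSucc.castSucc.succ.succ.succ) (by
    intro i j hij
    simpa [Fin.ext_iff] using hij)
  convert this using 1
  funext i
  simp only [Function.comp, Fin.cons_succ, Fin.snoc_castSucc]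

/-- weight space of highest weight -/
theorem aux_weight {L : Type*} [AddCommGroup L] [Module ℂ L]
    (m : ℕ) (x : ℕ → L) (hx : LinearIndependent ℂ (fun i : Fin (m + 1) => x i))
    (H : L →ₗ[ℂ] L) (hxh : ∀ k ≤ m, H (x k) = ((m : ℂ) - 2 * k) • x k)
    (v : L) (hv : v ∈ Submodule.span ℂ (x '' {k | k ≤ m})) (hvh : H v = (m : ℂ) • v) :
    ∃ a : ℂ, v = a • x 0 := by
  have h2 : x '' {k | k ≤ m} = Set.range (fun i : Fin (m + 1) => x i) := by
    ext t
    constructor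
    · rintro ⟨k, hk, rfl⟩
      exact ⟨⟨k, Nat.lt_succ_iff.mpr hk⟩, rfl⟩
    · rintro ⟨i, rfl⟩
      exact ⟨i, Nat.lt_succ_iff.mp i.2, rfl⟩
  rw [h2, Submodule.mem_span_range_iff_exists_fun] at hv
  obtain ⟨c, rfl⟩ := hv
  have h3 : ∑ i : Fin (m+1), (c i * (-2 * ((i : ℕ) : ℂ))) • x i = 0 := by
    rw [← sub_eq_zero.mpr hvh, map_sum, Finset.smul_sum, ← Finset.sum_sub_distrib]
    refine Finset.sum_congr rfl fun i _ => ?_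
    rw [map_smul, hxh i (Nat.lt_succ_iff.mp i.2)]
    module
  have h4 := Fintype.linearIndependent_iff.mp hx _ h3
  refine ⟨c 0, ?_⟩
  rw [Fin.sum_univ_succ, Finset.sum_eq_zero]
  · simp
  · intro i _
    have h5 := h4 i.succ
    have h6 : c i.succ = 0 := by
      rcases mul_eq_zero.mp h5 with h | h
      · exact h
      · exfalso
        have : ((i : ℕ) : ℂ) + 1 ≠ 0 := Nat.cast_add_one_ne_zero _
        apply this
        simpa using h
    rw [h6, zero_smul]

/-- first main theorem of the paper: Let `L` be a complex Leibniz algebra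
with basis `{e, h, f, x_0, …, x_m, y₁, y₂}` such that `L/I ≅ sl₂ ⊕ R` with `R` a
two-dimensional solvable ideal and `I = span{x_0,…,x_m}` a right irreducible `sl₂`-module
with `dim I = m + 1 ≠ 3` (i.e. `m ≠ 2`). Then there exist `a ∈ ℂ` and `y₂' ∈ L` with
`y₂' - y₂ ∈ I` such that `{e, h, f, x_0, …, x_m, y₁, y₂'}` is a basis of `L` in which the
only nonzero brackets among basis vectors are those of `sl₂`, its action on `I`,
`[y₁,y₂'] = y₁`, `[y₂',y₁] = -y₁`, and `[x_k,y₂'] = a•x_k`. -/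
theorem leibniz_sl2_plus_R_dim2_classification
    (L : Type*) [AddCommGroup L] [Module ℂ L]
    (br : L →ₗ[ℂ] L →ₗ[ℂ] L)
    (leib : ∀ x y z : L, br x (br y z) = br (br x y) z - br (br x z) y)
    (m : ℕ) (hm : 1 ≤ m)
    (e h f : L) (x : ℕ → L) (y₁ y₂ : L)
    (hind : LinearIndependent ℂ
      (Fin.cons e (Fin.cons h (Fin.cons f
        (Fin.snoc (Fin.snoc (fun i : Fin (m + 1) => x i) y₁) y₂)))))
    (hspan : Submodule.span ℂ (Set.range
      (Fin.cons e (Fin.cons h (Fin.cons f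
        (Fin.snoc (Fin.snoc (fun i : Fin (m + 1) => x i) y₁) y₂))))) = ⊤)
    (heh : br e h = (2 : ℂ) • e) (hhf : br h f = (2 : ℂ) • f) (hef : br e f = h)
    (hhe : br h e = (-2 : ℂ) • e) (hfh : br f h = (-2 : ℂ) • f) (hfe : br f e = -h)
    (hee : br e e = 0) (hff : br f f = 0) (hhh : br h h = 0)
    (hxh : ∀ k ≤ m, br (x k) h = ((m : ℂ) - 2 * k) • x k)
    (hxf : ∀ k < m, br (x k) f = x (k + 1)) (hxmf : br (x m) f = 0)
    (hxe : ∀ k, 1 ≤ k → k ≤ m →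
      br (x k) e = (-(k : ℂ) * ((m : ℂ) + 1 - (k : ℂ))) • x (k - 1))
    (hx0e : br (x 0) e = 0)
    (hzx : ∀ z : L, ∀ k ≤ m, br z (x k) = 0)
    (hey1 : br e y₁ ∈ Submodule.span ℂ (x '' {k | k ≤ m}))
    (hfy1 : br f y₁ ∈ Submodule.span ℂ (x '' {k | k ≤ m}))
    (hhy1 : br h y₁ ∈ Submodule.span ℂ (x '' {k | k ≤ m}))
    (hey2 : br e y₂ ∈ Submodule.span ℂ (x '' {k | k ≤ m}))
    (hfy2 : br f y₂ ∈ Submodule.span ℂ (x '' {k | k ≤ m}))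
    (hhy2 : br h y₂ ∈ Submodule.span ℂ (x '' {k | k ≤ m}))
    (hy1e : br y₁ e ∈ Submodule.span ℂ (x '' {k | k ≤ m}))
    (hy1f : br y₁ f ∈ Submodule.span ℂ (x '' {k | k ≤ m}))
    (hy1h : br y₁ h ∈ Submodule.span ℂ (x '' {k | k ≤ m}))
    (hy1y1 : br y₁ y₁ ∈ Submodule.span ℂ (x '' {k | k ≤ m}))
    (hy2e : br y₂ e ∈ Submodule.span ℂ (x '' {k | k ≤ m}))
    (hy2f : br y₂ f ∈ Submodule.span ℂ (x '' {k | k ≤ m}))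
    (hy2h : br y₂ h ∈ Submodule.span ℂ (x '' {k | k ≤ m}))
    (hy2y2 : br y₂ y₂ ∈ Submodule.span ℂ (x '' {k | k ≤ m}))
    (hxy1 : ∀ k ≤ m, br (x k) y₁ ∈ Submodule.span ℂ (x '' {k | k ≤ m}))
    (hxy2 : ∀ k ≤ m, br (x k) y₂ ∈ Submodule.span ℂ (x '' {k | k ≤ m}))
    (hy12 : br y₁ y₂ - y₁ ∈ Submodule.span ℂ (x '' {k | k ≤ m}))
    (hy21 : br y₂ y₁ = -y₁)
    (hm2 : m ≠ 2) :
    ∃ (a : ℂ) (y₂' : L), y₂' - y₂ ∈ Submodule.span ℂ (x '' {k | k ≤ m}) ∧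
      -- the new family is again a basis of L
      LinearIndependent ℂ
        (Fin.cons e (Fin.cons h (Fin.cons f
          (Fin.snoc (Fin.snoc (fun i : Fin (m + 1) => x i) y₁) y₂')))) ∧
      Submodule.span ℂ (Set.range
        (Fin.cons e (Fin.cons h (Fin.cons f
          (Fin.snoc (Fin.snoc (fun i : Fin (m + 1) => x i) y₁) y₂'))))) = ⊤ ∧
      -- the listed nonzero brackets
      br y₁ y₂' = y₁ ∧ br y₂' y₁ = -y₁ ∧
      (∀ k ≤ m, br (x k) y₂' = a • x k) ∧
      -- all the remaining brackets among basis vectors vanish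
      br e y₁ = 0 ∧ br f y₁ = 0 ∧ br h y₁ = 0 ∧
      br e y₂' = 0 ∧ br f y₂' = 0 ∧ br h y₂' = 0 ∧
      br y₁ e = 0 ∧ br y₁ f = 0 ∧ br y₁ h = 0 ∧
      br y₂' e = 0 ∧ br y₂' f = 0 ∧ br y₂' h = 0 ∧
      br y₁ y₁ = 0 ∧ br y₂' y₂' = 0 ∧
      (∀ k ≤ m, br (x k) y₁ = 0) := by
  set I := Submodule.span ℂ (x '' {k | k ≤ m}) with hI
  have hxI : ∀ k ≤ m, x k ∈ I := fun k hk => Submodule.subset_span ⟨k, hk, rfl⟩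
  have hindx := aux_indep m e h f x y₁ y₂ hind
  -- brackets into I vanish
  have hzI : ∀ z, ∀ w ∈ I, br z w = 0 := by
    intro z w hw
    have : I ≤ LinearMap.ker (br z) := by
      rw [hI, Submodule.span_le]
      rintro _ ⟨k, hk, rfl⟩
      exact hzx z k hk
    exact this hw
  -- linear maps preserving I
  have hpres : ∀ z, (∀ k ≤ m, br (x k) z ∈ I) → ∀ w ∈ I, br w z ∈ I := by
    intro z hz w hw
    have : I ≤ I.comap (br.flip z) := by
      conv_lhs => rw [hI]
      rw [Submodule.span_le]
      rintro _ ⟨k, hk, rfl⟩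
      exact hz k hk
    exact this hw
  have hIe : ∀ w ∈ I, br w e ∈ I := hpres e (by
    intro k hk
    rcases Nat.eq_zero_or_pos k with rfl | h0
    · rw [hx0e]; exact I.zero_mem
    · rw [hxe k h0 hk]; exact I.smul_mem _ (hxI _ (by omega)))
  have hIf : ∀ w ∈ I, br w f ∈ I := hpres f (by
    intro k hk
    rcases Nat.lt_or_ge k m with h0 | h0
    · rw [hxf k h0]; exact hxI _ (by omega)
    · obtain rfl : k = m := by omega
      rw [hxmf]; exact I.zero_mem)
  have hIh : ∀ w ∈ I, br w h ∈ I := hpres h (by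
    intro k hk
    rw [hxh k hk]; exact I.smul_mem _ (hxI _ hk))
  have hIy2 := hpres y₂ hxy2
  have hIy1 := hpres y₁ hxy1
  -- Casimir
  have hmC : (m : ℂ) ≠ 0 := by exact_mod_cast (by omega : m ≠ 0)
  have hm2C : (m : ℂ) + 2 ≠ 0 := by exact_mod_cast (by omega : m + 2 ≠ 0)
  have hcas : ∀ w ∈ I, (1/2 : ℂ) • br (br w h) h - br (br w e) f - br (br w f) e
      = ((m : ℂ) * (m + 2) / 2) • w := by
    intro w hw
    have hef' : ∀ u, br (br u e) f = br u h + br (br u f) e := by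
      intro u
      have := leib u e f
      rw [hef] at this
      rw [this]; abel
    have hxfe : ∀ k ≤ m, br (br (x k) f) e = (-((k : ℂ) + 1) * ((m : ℂ) - k)) • x k := by
      intro k hk
      rcases Nat.lt_or_ge k m with h0 | h0
      · rw [hxf k h0, hxe (k+1) (by omega) (by omega)]
        simp only [Nat.add_sub_cancel]
        push_cast
        congr 1
        ring
      · obtain rfl : k = m := by omega
        rw [hxmf]; simp
    have : I ≤ LinearMap.ker ((1/2 : ℂ) • (br.flip h ∘ₗ br.flip h) - br.flip f ∘ₗ br.flip e
        - br.flip e ∘ₗ br.flip f - ((m : ℂ) * (m + 2) / 2) • LinearMap.id) := by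
      rw [hI, Submodule.span_le]
      rintro _ ⟨k, hk, rfl⟩
      simp only [SetLike.mem_coe, LinearMap.mem_ker, LinearMap.sub_apply, LinearMap.smul_apply,
        LinearMap.comp_apply, LinearMap.flip_apply, LinearMap.id_apply]
      rw [hef', hxfe k hk, hxh k hk, map_smul, LinearMap.smul_apply, hxh k hk]
      module
    have h1 := this hw
    simp only [LinearMap.mem_ker, LinearMap.sub_apply, LinearMap.smul_apply,
        LinearMap.comp_apply, LinearMap.flip_apply, LinearMap.id_apply] at h1
    exact sub_eq_zero.mp h1
  have hlam : ((m : ℂ) * (m + 2) / 2) ≠ 0 :=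
    div_ne_zero (mul_ne_zero hmC hm2C) two_ne_zero
  have hinv : ∀ w ∈ I, br w e = 0 → br w f = 0 → br w h = 0 → w = 0 := by
    intro w hw h1 h2 h3
    have := hcas w hw
    rw [h1, h2, h3] at this
    simp only [map_zero, LinearMap.zero_apply, smul_zero, sub_zero] at this
    exact (smul_eq_zero.mp this.symm).resolve_left hlam
  -- commutation
  have hcomm : ∀ s y, br s y ∈ I → ∀ u, br (br u s) y = br (br u y) s := by
    intro s y hs u
    have := leib u s y
    rw [hzI u _ hs] at this
    exact (sub_eq_zero.mp this.symm)
  -- homs from the adjoint module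
  have hadj : ∀ y, br e y ∈ I → br f y ∈ I → br h y ∈ I →
      br e y = 0 ∧ br f y = 0 ∧ br h y = 0 := by
    intro y hey hfy hhy
    have c1 : br (br f y) f = 0 := by
      rw [← hcomm f y hfy, hff]; simp
    have c2 : br (br f y) h = (-2 : ℂ) • br f y := by
      rw [← hcomm h y hhy, hfh]; simp
    have c3 : br (br (br f y) e) f = (-2 : ℂ) • br f y := by
      have := leib (br f y) e f
      rw [hef, c1, c2] at this
      rw [this]; simp
    have c4 := hcas _ hfy
    rw [c3, c1, c2, map_smul, LinearMap.smul_apply, c2] at c4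
    have c5 : (((m : ℂ) - 2) * (m + 4)) • br f y = 0 := by
      rw [map_zero, LinearMap.zero_apply] at c4
      have c4' := sub_eq_zero.mpr c4.symm
      have c6 := congrArg (fun t : L => (2 : ℂ) • t) c4'
      simp only [smul_zero] at c6
      refine Eq.trans ?_ c6
      module
    have hm4 : (m : ℂ) + 4 ≠ 0 := by exact_mod_cast (by omega : m + 4 ≠ 0)
    have hm2' : (m : ℂ) - 2 ≠ 0 := by
      rw [sub_ne_zero]; exact_mod_cast hm2
    have hf0 := (smul_eq_zero.mp c5).resolve_left (mul_ne_zero hm2' hm4)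
    have hh0 : br h y = 0 := by
      have := hcomm e y hey f
      rw [hfe, hf0] at this
      simpa using this
    have he0 : br e y = 0 := by
      have := hcomm e y hey h
      rw [hhe, hh0] at this
      simpa using this
    exact ⟨he0, hf0, hh0⟩
  obtain ⟨hey1', hfy1', hhy1'⟩ := hadj y₁ hey1 hfy1 hhy1
  obtain ⟨hey2', hfy2', hhy2'⟩ := hadj y₂ hey2 hfy2 hhy2
  -- Schur
  have hschur : ∀ y, br e y ∈ I → br f y ∈ I → br h y ∈ I → (∀ k ≤ m, br (x k) y ∈ I) →
      ∃ a : ℂ, ∀ w ∈ I, br w y = a • w := by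
    intro y hey hfy hhy hxy
    obtain ⟨a, ha⟩ := aux_weight m x hindx (br.flip h) (by simpa using hxh) (br (x 0) y)
      (hxy 0 (by omega)) (by
        rw [LinearMap.flip_apply, ← hcomm h y hhy, hxh 0 (by omega)]; simp)
    have hk : ∀ k ≤ m, br (x k) y = a • x k := by
      intro k
      induction k with
      | zero => intro _; exact ha
      | succ k ih =>
        intro hk
        rw [← hxf k (by omega), hcomm f y hfy, ih (by omega)]
        simp
    refine ⟨a, fun w hw => ?_⟩
    have : I ≤ LinearMap.ker (br.flip y - a • LinearMap.id) := by
      rw [hI, Submodule.span_le]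
      rintro _ ⟨k, hk', rfl⟩
      simp [hk k hk']
    have h1 := this hw
    simpa [sub_eq_zero] using h1
  obtain ⟨a₁, ha₁⟩ := hschur y₁ hey1 hfy1 hhy1 hxy1
  obtain ⟨a, ha⟩ := hschur y₂ hey2 hfy2 hhy2 hxy2
  have hIy1z : ∀ w ∈ I, br w y₁ = 0 := by
    intro w hw
    have h1 := leib w y₁ y₂
    have h2 : br w (br y₁ y₂) = br w y₁ := by
      rw [← sub_eq_zero, ← map_sub]; exact hzI _ _ hy12
    rw [h2, ha₁ w hw, ha w hw] at h1
    rw [ha₁ w hw, h1]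
    simp only [map_smul, LinearMap.smul_apply, ha₁ w hw, ha w hw]
    module
  -- y₁ commutes with sl₂
  have hy1s : ∀ s, br s y₁ ∈ I → br y₂ s ∈ I → br y₁ s = 0 := by
    intro s h1 h2
    have h3 := hcomm s y₁ h1 y₂
    rw [hIy1z _ h2, hy21] at h3
    simpa using h3
  have hy1e' := hy1s e hey1 hy2e
  have hy1f' := hy1s f hfy1 hy2f
  have hy1h' := hy1s h hhy1 hy2h
  have hkill : ∀ z y s, br s y ∈ I → br z s = 0 → br (br z y) s = 0 := by
    intro z y s h1 h2
    rw [← hcomm s y h1, h2]; simp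
  have hy11 : br y₁ y₁ = 0 := hinv _ hy1y1 (hkill _ _ _ hey1 hy1e') (hkill _ _ _ hfy1 hy1f')
    (hkill _ _ _ hhy1 hy1h')
  have hy12' : br y₁ y₂ = y₁ := by
    have k : ∀ s, br s y₂ ∈ I → br y₁ s = 0 → br (br y₁ y₂ - y₁) s = 0 := by
      intro s h1 h2
      rw [map_sub, LinearMap.sub_apply, hkill _ _ _ h1 h2, h2, sub_zero]
    exact sub_eq_zero.mp (hinv _ hy12 (k _ hey2 hy1e') (k _ hfy2 hy1f') (k _ hhy2 hy1h'))
  -- Whitehead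
  set lam : ℂ := (m : ℂ) * (m + 2) / 2 with hlamdef
  obtain ⟨v, hvI, hve, hvf, hvh⟩ : ∃ v ∈ I, br v e = br y₂ e ∧ br v f = br y₂ f ∧
      br v h = br y₂ h := by
    -- rewriting brackets of sl₂
    have re : ∀ u, br (br u h) e = br (br u e) h - (2 : ℂ) • br u e := by
      intro u
      have := leib u e h
      rw [heh, map_smul] at this
      rw [this]; abel
    have rf : ∀ u, br (br u f) h = br (br u h) f - (2 : ℂ) • br u f := by
      intro u
      have := leib u h f
      rw [hhf, map_smul] at this
      rw [this]; abel
    have rh : ∀ u, br (br u f) e = br (br u e) f - br u h := by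
      intro u
      have := leib u e f
      rw [hef] at this
      rw [this]; abel
    refine ⟨lam⁻¹ • ((1/2 : ℂ) • br (br y₂ h) h - br (br y₂ e) f - br (br y₂ f) e),
      I.smul_mem _ (I.sub_mem (I.sub_mem (I.smul_mem _ (hIh _ hy2h)) (hIf _ hy2e))
        (hIe _ hy2f)), ?_, ?_, ?_⟩
    · rw [map_smul, LinearMap.smul_apply, inv_smul_eq_iff₀ hlam, ← hcas _ hy2e]
      simp only [map_sub, map_smul, LinearMap.sub_apply, LinearMap.smul_apply, re, rf, rh]
      module
    · rw [map_smul, LinearMap.smul_apply, inv_smul_eq_iff₀ hlam, ← hcas _ hy2f]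
      simp only [map_sub, map_smul, LinearMap.sub_apply, LinearMap.smul_apply, re, rf, rh]
      module
    · rw [map_smul, LinearMap.smul_apply, inv_smul_eq_iff₀ hlam, ← hcas _ hy2h]
      simp only [map_sub, map_smul, LinearMap.sub_apply, LinearMap.smul_apply, re, rf, rh]
  have hsub : ∀ z, br z (y₂ - v) = br z y₂ := by
    intro z; rw [map_sub, hzI z v hvI, sub_zero]
  have hye : br (y₂ - v) e = 0 := by rw [map_sub, LinearMap.sub_apply, hve, sub_self]
  have hyf : br (y₂ - v) f = 0 := by rw [map_sub, LinearMap.sub_apply, hvf, sub_self]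
  have hyh : br (y₂ - v) h = 0 := by rw [map_sub, LinearMap.sub_apply, hvh, sub_self]
  have hspan' : Submodule.span ℂ (Set.range
        (Fin.cons e (Fin.cons h (Fin.cons f
          (Fin.snoc (Fin.snoc (fun i : Fin (m + 1) => x i) y₁) (y₂ - v)))) :
            Fin (m+1+1+1+1+1+1) → L)) = ⊤ := by
    rw [eq_top_iff, ← hspan, Submodule.span_le]
    erw [aux_range, aux_range]
    set S := Submodule.span ℂ
      (insert e (insert h (insert f (insert (y₂ - v) (insert y₁ (x '' {k | k ≤ m})))))) with hS
    have hIS : I ≤ S := Submodule.span_mono (by intro t ht; simp only [Set.mem_insert_iff]; tauto)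
    have hy : y₂ - v ∈ S := Submodule.subset_span (by simp)
    rintro t (rfl | rfl | rfl | rfl | rfl | ht)
    · exact Submodule.subset_span (by simp)
    · exact Submodule.subset_span (by simp)
    · exact Submodule.subset_span (by simp)
    · have := S.add_mem hy (hIS hvI)
      simpa using this
    · exact Submodule.subset_span (by simp)
    · exact hIS (Submodule.subset_span ht)
  refine ⟨a, y₂ - v, ?_, ?_, hspan', ?_, ?_, ?_, hey1', hfy1', hhy1', ?_, ?_, ?_,
    hy1e', hy1f', hy1h', hye, hyf, hyh, hy11, ?_, fun k hk => hIy1z _ (hxI k hk)⟩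
  · have : y₂ - v - y₂ = -v := by abel
    rw [this]; exact I.neg_mem hvI
  · apply linearIndependent_of_top_le_span_of_card_eq_finrank hspan'.ge
    rw [Module.finrank_eq_card_basis (Module.Basis.mk hind hspan.ge)]
  · rw [hsub, hy12']
  · rw [map_sub, LinearMap.sub_apply, hy21, hIy1z v hvI, sub_zero]
  · intro k hk
    rw [hsub, ha _ (hxI k hk)]
  · rw [hsub, hey2']
  · rw [hsub, hfy2']
  · rw [hsub, hhy2']
  · rw [hsub]
    refine hinv _ ?_ (hkill _ _ _ hey2 hye) (hkill _ _ _ hfy2 hyf) (hkill _ _ _ hhy2 hyh)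
    rw [map_sub, LinearMap.sub_apply]
    exact I.sub_mem hy2y2 (hIy2 _ hvI)
end

section
/- The bracket of L(λ,μ,a) satisfies the Leibniz identity [x,[y,z]] = [[x,y],z] − [[x,z],y] for all x, y, z if and only if λ(1−a) = 0. -/
/-- The standard basis vector `eᵢ` of `ℂ⁸`, with coordinates indexed by
`0 = e, 1 = h, 2 = f, 3 = x₀, 4 = x₁, 5 = x₂, 6 = y₁, 7 = y₂`. -/
noncomputable def b8 (i : Fin 8) : Fin 8 → ℂ := Pi.single i 1

/-- Structure constants of the algebra `L(λ,μ,a)`: `sc λ μ a i j` is the product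
`[bᵢ, bⱼ]` of the `i`-th and `j`-th basis vectors. -/
noncomputable def sc (lam mu a : ℂ) (i j : Fin 8) : Fin 8 → ℂ :=
  match i.val, j.val with
  | 0, 1 => (2 : ℂ) • b8 0      -- [e,h] = 2e
  | 1, 2 => (2 : ℂ) • b8 2      -- [h,f] = 2f
  | 0, 2 => b8 1                -- [e,f] = h
  | 1, 0 => (-2 : ℂ) • b8 0     -- [h,e] = -2e
  | 2, 1 => (-2 : ℂ) • b8 2     -- [f,h] = -2f
  | 2, 0 => -b8 1               -- [f,e] = -h
  | 4, 0 => (-2 : ℂ) • b8 3     -- [x₁,e] = -2x₀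
  | 5, 0 => (-2 : ℂ) • b8 4     -- [x₂,e] = -2x₁
  | 3, 2 => b8 4                -- [x₀,f] = x₁
  | 4, 2 => b8 5                -- [x₁,f] = x₂
  | 3, 1 => (2 : ℂ) • b8 3      -- [x₀,h] = 2x₀
  | 5, 1 => (-2 : ℂ) • b8 5     -- [x₂,h] = -2x₂
  | 0, 6 => lam • b8 3          -- [e,y₁] = λx₀
  | 2, 6 => (lam / 2) • b8 5    -- [f,y₁] = (λ/2)x₂
  | 1, 6 => lam • b8 4          -- [h,y₁] = λx₁
  | 0, 7 => mu • b8 3           -- [e,y₂] = μx₀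
  | 2, 7 => (mu / 2) • b8 5     -- [f,y₂] = (μ/2)x₂
  | 1, 7 => mu • b8 4           -- [h,y₂] = μx₁
  | 3, 7 => a • b8 3            -- [x₀,y₂] = a·x₀
  | 4, 7 => a • b8 4            -- [x₁,y₂] = a·x₁
  | 5, 7 => a • b8 5            -- [x₂,y₂] = a·x₂
  | 6, 7 => b8 6                -- [y₁,y₂] = y₁
  | 7, 6 => -b8 6               -- [y₂,y₁] = -y₁
  | _, _ => 0

/-- The (bilinear) bracket of the 8-dimensional algebra `L(λ,μ,a)` on `ℂ⁸`. -/
noncomputable def lbr (lam mu a : ℂ) (u v : Fin 8 → ℂ) : Fin 8 → ℂ :=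
  ∑ i : Fin 8, ∑ j : Fin 8, (u i * v j) • sc lam mu a i j

set_option maxHeartbeats 4000000 in
/-- Coordinates of the bracket. -/
lemma lbr_coords (lam mu a : ℂ) (u v : Fin 8 → ℂ) :
    lbr lam mu a u v =
      ![2 * u 0 * v 1 - 2 * u 1 * v 0,
        u 0 * v 2 - u 2 * v 0,
        2 * u 1 * v 2 - 2 * u 2 * v 1,
        -2 * u 4 * v 0 + 2 * u 3 * v 1 + lam * u 0 * v 6 + mu * u 0 * v 7 + a * u 3 * v 7,
        -2 * u 5 * v 0 + u 3 * v 2 + lam * u 1 * v 6 + mu * u 1 * v 7 + a * u 4 * v 7,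
        u 4 * v 2 - 2 * u 5 * v 1 + lam / 2 * u 2 * v 6 + mu / 2 * u 2 * v 7 + a * u 5 * v 7,
        u 6 * v 7 - u 7 * v 6,
        0] := by
  funext k
  fin_cases k <;> simp [lbr, sc, b8, Fin.sum_univ_eight, Pi.single_apply] <;> ring

/-- The bracket of `L(λ,μ,a)` satisfies the (right) Leibniz identity
`[x,[y,z]] = [[x,y],z] - [[x,z],y]` for all `x, y, z` if and only if `λ(1-a) = 0`. -/
theorem L_lam_mu_a_leibniz_iff (lam mu a : ℂ) :
    (∀ u v w : Fin 8 → ℂ,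
      lbr lam mu a u (lbr lam mu a v w) =
        lbr lam mu a (lbr lam mu a u v) w - lbr lam mu a (lbr lam mu a u w) v)
    ↔ lam * (1 - a) = 0 := by
  constructor
  · intro H
    have h := congrFun (H (b8 0) (b8 6) (b8 7)) 3
    simp [lbr_coords, b8, Pi.single_apply] at h
    linear_combination h
  · intro H u v w
    simp only [lbr_coords]
    funext k
    fin_cases k <;> simp
    · ring
    · ring
    · ring
    · linear_combination (u 0 * (v 6 * w 7 - v 7 * w 6)) * H
    · linear_combination (u 1 * (v 6 * w 7 - v 7 * w 6)) * H
    · linear_combination (u 2 * (v 6 * w 7 - v 7 * w 6) / 2) * H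
    · ring
end

section
/- Let L be a complex Leibniz algebra with basis {e, h, f, x_0, x_1, x_2, y₁, y₂} such that: [e,h] = 2e, [h,f] = 2f, [e,f] = h, [h,e] = −2e, [f,h] = −2f, [f,e] = −h, [e,e] = [f,f] = [h,h] = 0; [x_0,h] = 2x_0, [x_1,h] = 0, [x_2,h] = −2x_2, [x_0,f] = x_1, [x_1,f] = x_2, [x_2,f] = 0, [x_0,e] = 0, [x_1,e] = −2x_0, [x_2,e] = −2x_1; [z,x_k] = 0 for every z ∈ L and k = 0,1,2; [e,y_i], [f,y_i], [h,y_i], [y_i,e], [y_i,f], [y_i,h], [y_i,y_i] ∈ I and [x_k,y_i] ∈ I for i = 1,2 and k = 0,1,2; [y₁,y₂] − y₁ ∈ I; and [y₂,y₁] = −y₁, where I = span{x_0, x_1, x_2}. Then L is isomorphic as a Leibniz algebra to L(1,0,1), or to L(0,1,a) for some a ∈ ℂ, or to L(0,0,a) for some a ∈ ℂ. -/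
/-- An algebra with a basis satisfying the multiplication table of `L(λ,μ,a)` is isomorphic to it. -/
lemma iso_of_table {L : Type*} [AddCommGroup L] [Module ℂ L]
    (br : L →ₗ[ℂ] L →ₗ[ℂ] L) (lam mu a : ℂ) (B : Module.Basis (Fin 8) ℂ L)
    (H : ∀ i j, br (B i) (B j) = ∑ k, sc lam mu a i j k • B k) :
    ∃ φ : L ≃ₗ[ℂ] (Fin 8 → ℂ), ∀ u v, φ (br u v) = lbr lam mu a (φ u) (φ v) := by
  refine ⟨B.equivFun, fun u v => ?_⟩
  have key : br u v = ∑ i, ∑ j, (B.equivFun u i * B.equivFun v j) • br (B i) (B j) := by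
    conv_lhs => rw [← B.sum_equivFun u, ← B.sum_equivFun v]
    simp only [map_sum, LinearMap.sum_apply, map_smul, LinearMap.smul_apply, Finset.smul_sum,
      smul_smul]
    rw [Finset.sum_comm]
    refine Finset.sum_congr rfl fun i _ => Finset.sum_congr rfl fun j _ => ?_
    rw [mul_comm]
  have h2 : ∀ i j, B.equivFun (br (B i) (B j)) = sc lam mu a i j := by
    intro i j
    rw [H]
    rw [← B.equivFun_symm_apply, LinearEquiv.apply_symm_apply]
  rw [key]
  simp only [map_sum, map_smul, h2, lbr]

/-- Change of basis in an algebra with the multiplication table of `L(λ,μ,a)`. -/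
lemma iso_of_rescale {L : Type*} [AddCommGroup L] [Module ℂ L]
    (br : L →ₗ[ℂ] L →ₗ[ℂ] L) (lam mu a lam' mu' c d t : ℂ) (hc : c ≠ 0) (hd : d ≠ 0)
    (hl : d * lam = lam' * c) (hm : mu + t * lam = mu' * c)
    (hrank : Module.finrank ℂ L = 8)
    (e h f x₀ x₁ x₂ y₁ y₂ : L)
    (hspan : Submodule.span ℂ (Set.range ![e, h, f, x₀, x₁, x₂, y₁, y₂]) = ⊤)
    (heh : br e h = (2 : ℂ) • e) (hhf : br h f = (2 : ℂ) • f) (hef : br e f = h)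
    (hhe : br h e = (-2 : ℂ) • e) (hfh : br f h = (-2 : ℂ) • f) (hfe : br f e = -h)
    (hee : br e e = 0) (hff : br f f = 0) (hhh : br h h = 0)
    (hx0h : br x₀ h = (2 : ℂ) • x₀) (hx1h : br x₁ h = 0) (hx2h : br x₂ h = (-2 : ℂ) • x₂)
    (hx0f : br x₀ f = x₁) (hx1f : br x₁ f = x₂) (hx2f : br x₂ f = 0)
    (hx0e : br x₀ e = 0) (hx1e : br x₁ e = (-2 : ℂ) • x₀) (hx2e : br x₂ e = (-2 : ℂ) • x₁)
    (hzx0 : ∀ z : L, br z x₀ = 0) (hzx1 : ∀ z : L, br z x₁ = 0)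
    (hzx2 : ∀ z : L, br z x₂ = 0)
    (hey1 : br e y₁ = lam • x₀) (hhy1 : br h y₁ = lam • x₁) (hfy1 : br f y₁ = (lam / 2) • x₂)
    (hey2 : br e y₂ = mu • x₀) (hhy2 : br h y₂ = mu • x₁) (hfy2 : br f y₂ = (mu / 2) • x₂)
    (hy1e : br y₁ e = 0) (hy1h : br y₁ h = 0) (hy1f : br y₁ f = 0)
    (hy2e : br y₂ e = 0) (hy2h : br y₂ h = 0) (hy2f : br y₂ f = 0)
    (hx0y1 : br x₀ y₁ = 0) (hx1y1 : br x₁ y₁ = 0) (hx2y1 : br x₂ y₁ = 0)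
    (hx0y2 : br x₀ y₂ = a • x₀) (hx1y2 : br x₁ y₂ = a • x₁) (hx2y2 : br x₂ y₂ = a • x₂)
    (hy11 : br y₁ y₁ = 0) (hy22 : br y₂ y₂ = 0) (hy12 : br y₁ y₂ = y₁) (hy21 : br y₂ y₁ = -y₁) :
    ∃ φ : L ≃ₗ[ℂ] (Fin 8 → ℂ), ∀ u v, φ (br u v) = lbr lam' mu' a (φ u) (φ v) := by
  set w : Fin 8 → L := ![e, h, f, c • x₀, c • x₁, c • x₂, d • y₁, y₂ + t • y₁] with hw
  have hsp : ⊤ ≤ Submodule.span ℂ (Set.range w) := by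
    have hm' : ∀ i, w i ∈ Submodule.span ℂ (Set.range w) :=
      fun i => Submodule.subset_span ⟨i, rfl⟩
    have h0 : e ∈ Submodule.span ℂ (Set.range w) := hm' 0
    have h1 : h ∈ Submodule.span ℂ (Set.range w) := hm' 1
    have h2 : f ∈ Submodule.span ℂ (Set.range w) := hm' 2
    have h3 : c • x₀ ∈ Submodule.span ℂ (Set.range w) := hm' 3
    have h4 : c • x₁ ∈ Submodule.span ℂ (Set.range w) := hm' 4
    have h5 : c • x₂ ∈ Submodule.span ℂ (Set.range w) := hm' 5
    have h6 : d • y₁ ∈ Submodule.span ℂ (Set.range w) := hm' 6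
    have h7 : y₂ + t • y₁ ∈ Submodule.span ℂ (Set.range w) := hm' 7
    rw [← hspan]
    clear_value w
    generalize Submodule.span ℂ (Set.range w) = S at *
    rw [Submodule.smul_mem_iff _ hc] at h3 h4 h5
    rw [Submodule.smul_mem_iff _ hd] at h6
    rw [Submodule.add_mem_iff_left _ (Submodule.smul_mem _ t h6)] at h7
    rw [Submodule.span_le]
    simp only [Matrix.range_cons, Matrix.range_empty, Set.union_empty, Set.union_subset_iff,
      Set.singleton_subset_iff, SetLike.mem_coe]
    exact ⟨h0, h1, h2, h3, h4, h5, h6, h7⟩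
  let B := basisOfTopLeSpanOfCardEqFinrank w hsp (by simp [hrank])
  have hB : ∀ i, B i = w i := fun i => by simp [B]
  let Φ : (Fin 8 → ℂ) →ₗ[ℂ] L := B.equivFun.symm.toLinearMap
  have hΦ : ∀ k, Φ (b8 k) = w k := fun k => by
    rw [← hB]
    simp [Φ, b8, B.equivFun_symm_apply, Pi.single_apply]
  have hΦ0 : Φ (b8 0) = e := hΦ 0
  have hΦ1 : Φ (b8 1) = h := hΦ 1
  have hΦ2 : Φ (b8 2) = f := hΦ 2
  have hΦ3 : Φ (b8 3) = c • x₀ := hΦ 3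
  have hΦ4 : Φ (b8 4) = c • x₁ := hΦ 4
  have hΦ5 : Φ (b8 5) = c • x₂ := hΦ 5
  have hΦ6 : Φ (b8 6) = d • y₁ := hΦ 6
  have hΦ7 : Φ (b8 7) = y₂ + t • y₁ := hΦ 7
  have hl2 : d * (lam / 2) = lam' / 2 * c := by linear_combination hl / 2
  have hm2 : mu / 2 + t * (lam / 2) = mu' / 2 * c := by linear_combination hm / 2
  have main : ∀ i j, br (Φ (b8 i)) (Φ (b8 j)) = Φ (sc lam' mu' a i j) := by
    clear_value Φ
    clear hΦ hB B hsp hw w hspan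
    intro i j
    fin_cases i <;> fin_cases j <;>
    simp [sc, hΦ0, hΦ1, hΦ2, hΦ3, hΦ4, hΦ5, hΦ6, hΦ7, heh, hhf, hef, hhe, hfh, hfe, hee, hff,
      hhh, hx0h, hx1h, hx2h, hx0f, hx1f, hx2f, hx0e, hx1e, hx2e, hzx0, hzx1, hzx2, hey1, hhy1, hfy1,
      hey2, hhy2, hfy2, hy1e, hy1h, hy1f, hy2e, hy2h, hy2f, hx0y1, hx1y1, hx2y1, hx0y2, hx1y2,
      hx2y2, hy11, hy22, hy12, hy21, smul_smul, ← add_smul, hl, hm, hl2, hm2, mul_comm c]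
  refine iso_of_table br lam' mu' a B fun i j => ?_
  have := main i j
  rw [hΦ, hΦ] at this
  rw [hB, hB, this]
  exact B.equivFun_symm_apply _


/-- second main theorem of the paper: Let `L` be a complex Leibniz algebra
with basis `{e, h, f, x₀, x₁, x₂, y₁, y₂}` such that `L/I ≅ sl₂ ⊕ R` with `R` a
two-dimensional solvable ideal and `I = span{x₀,x₁,x₂}` a three-dimensional right
irreducible `sl₂`-module. Then `L` is isomorphic to `L(1,0,1)`, or to `L(0,1,a)` for some
`a ∈ ℂ`, or to `L(0,0,a)` for some `a ∈ ℂ`. -/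
theorem leibniz_sl2_plus_R_dimI3_classification
    (L : Type*) [AddCommGroup L] [Module ℂ L]
    (br : L →ₗ[ℂ] L →ₗ[ℂ] L)
    (leib : ∀ x y z : L, br x (br y z) = br (br x y) z - br (br x z) y)
    (e h f x₀ x₁ x₂ y₁ y₂ : L)
    (hind : LinearIndependent ℂ ![e, h, f, x₀, x₁, x₂, y₁, y₂])
    (hspan : Submodule.span ℂ (Set.range ![e, h, f, x₀, x₁, x₂, y₁, y₂]) = ⊤)
    (heh : br e h = (2 : ℂ) • e) (hhf : br h f = (2 : ℂ) • f) (hef : br e f = h)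
    (hhe : br h e = (-2 : ℂ) • e) (hfh : br f h = (-2 : ℂ) • f) (hfe : br f e = -h)
    (hee : br e e = 0) (hff : br f f = 0) (hhh : br h h = 0)
    (hx0h : br x₀ h = (2 : ℂ) • x₀) (hx1h : br x₁ h = 0) (hx2h : br x₂ h = (-2 : ℂ) • x₂)
    (hx0f : br x₀ f = x₁) (hx1f : br x₁ f = x₂) (hx2f : br x₂ f = 0)
    (hx0e : br x₀ e = 0) (hx1e : br x₁ e = (-2 : ℂ) • x₀) (hx2e : br x₂ e = (-2 : ℂ) • x₁)
    (hzx0 : ∀ z : L, br z x₀ = 0) (hzx1 : ∀ z : L, br z x₁ = 0)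
    (hzx2 : ∀ z : L, br z x₂ = 0)
    (hey1 : br e y₁ ∈ Submodule.span ℂ {x₀, x₁, x₂})
    (hfy1 : br f y₁ ∈ Submodule.span ℂ {x₀, x₁, x₂})
    (hhy1 : br h y₁ ∈ Submodule.span ℂ {x₀, x₁, x₂})
    (hey2 : br e y₂ ∈ Submodule.span ℂ {x₀, x₁, x₂})
    (hfy2 : br f y₂ ∈ Submodule.span ℂ {x₀, x₁, x₂})
    (hhy2 : br h y₂ ∈ Submodule.span ℂ {x₀, x₁, x₂})
    (hy1e : br y₁ e ∈ Submodule.span ℂ {x₀, x₁, x₂})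
    (hy1f : br y₁ f ∈ Submodule.span ℂ {x₀, x₁, x₂})
    (hy1h : br y₁ h ∈ Submodule.span ℂ {x₀, x₁, x₂})
    (hy1y1 : br y₁ y₁ ∈ Submodule.span ℂ {x₀, x₁, x₂})
    (hy2e : br y₂ e ∈ Submodule.span ℂ {x₀, x₁, x₂})
    (hy2f : br y₂ f ∈ Submodule.span ℂ {x₀, x₁, x₂})
    (hy2h : br y₂ h ∈ Submodule.span ℂ {x₀, x₁, x₂})
    (hy2y2 : br y₂ y₂ ∈ Submodule.span ℂ {x₀, x₁, x₂})
    (hx0y1 : br x₀ y₁ ∈ Submodule.span ℂ {x₀, x₁, x₂})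
    (hx1y1 : br x₁ y₁ ∈ Submodule.span ℂ {x₀, x₁, x₂})
    (hx2y1 : br x₂ y₁ ∈ Submodule.span ℂ {x₀, x₁, x₂})
    (hx0y2 : br x₀ y₂ ∈ Submodule.span ℂ {x₀, x₁, x₂})
    (hx1y2 : br x₁ y₂ ∈ Submodule.span ℂ {x₀, x₁, x₂})
    (hx2y2 : br x₂ y₂ ∈ Submodule.span ℂ {x₀, x₁, x₂})
    (hy12 : br y₁ y₂ - y₁ ∈ Submodule.span ℂ {x₀, x₁, x₂})
    (hy21 : br y₂ y₁ = -y₁) :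
    (∃ φ : L ≃ₗ[ℂ] (Fin 8 → ℂ), ∀ u v, φ (br u v) = lbr 1 0 1 (φ u) (φ v)) ∨
    (∃ a : ℂ, ∃ φ : L ≃ₗ[ℂ] (Fin 8 → ℂ), ∀ u v, φ (br u v) = lbr 0 1 a (φ u) (φ v)) ∨
    (∃ a : ℂ, ∃ φ : L ≃ₗ[ℂ] (Fin 8 → ℂ), ∀ u v, φ (br u v) = lbr 0 0 a (φ u) (φ v)) := by
  have ind3 : ∀ p q r : ℂ, p • x₀ + q • x₁ + r • x₂ = 0 → p = 0 ∧ q = 0 ∧ r = 0 := by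
    intro p q r hpqr
    have := Fintype.linearIndependent_iff.1 hind ![0, 0, 0, p, q, r, 0, 0]
      (by simpa [Fin.sum_univ_eight] using hpqr)
    exact ⟨this 3, this 4, this 5⟩
  have hrank : Module.finrank ℂ L = 8 := by
    have := Module.finrank_eq_card_basis (Module.Basis.mk hind hspan.ge)
    simpa using this
  have mem : ∀ w, w ∈ Submodule.span ℂ {x₀, x₁, x₂} → ∃ p q r : ℂ, w = p • x₀ + q • x₁ + r • x₂ := by
    intro w hw
    obtain ⟨p, q, r, hh⟩ := Submodule.mem_span_triple.1 hw
    exact ⟨p, q, r, hh.symm⟩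
  have bre : ∀ p q r : ℂ, br (p • x₀ + q • x₁ + r • x₂) e
      = (-2 * q) • x₀ + (-2 * r) • x₁ + (0 : ℂ) • x₂ := by
    intro p q r
    simp only [map_add, map_smul, LinearMap.add_apply, LinearMap.smul_apply, hx0e, hx1e, hx2e]
    module
  have brf : ∀ p q r : ℂ, br (p • x₀ + q • x₁ + r • x₂) f
      = (0 : ℂ) • x₀ + p • x₁ + q • x₂ := by
    intro p q r
    simp only [map_add, map_smul, LinearMap.add_apply, LinearMap.smul_apply, hx0f, hx1f, hx2f]
    module
  have brh : ∀ p q r : ℂ, br (p • x₀ + q • x₁ + r • x₂) h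
      = (2 * p) • x₀ + (0 : ℂ) • x₁ + (-2 * r) • x₂ := by
    intro p q r
    simp only [map_add, map_smul, LinearMap.add_apply, LinearMap.smul_apply, hx0h, hx1h, hx2h]
    module
  have inv0 : ∀ w, w ∈ Submodule.span ℂ {x₀, x₁, x₂} → br w f = 0 → br w h = 0 → w = 0 := by
    intro w hw hf hh
    obtain ⟨p, q, r, rfl⟩ := mem w hw
    rw [brf] at hf
    rw [brh] at hh
    obtain ⟨-, h1, h2⟩ := ind3 _ _ _ hf
    obtain ⟨-, -, h3⟩ := ind3 _ _ _ hh
    have h3 : r = 0 := by simpa using h3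
    simp [h1, h2, h3]
  have high : ∀ w, w ∈ Submodule.span ℂ {x₀, x₁, x₂} → br w e = 0 → ∃ p : ℂ, w = p • x₀ := by
    intro w hw he
    obtain ⟨p, q, r, rfl⟩ := mem w hw
    rw [bre] at he
    obtain ⟨h1, h2, -⟩ := ind3 _ _ _ he
    have h1 : q = 0 := by simpa using h1
    have h2 : r = 0 := by simpa using h2
    exact ⟨p, by simp [h1, h2]⟩
  have zI : ∀ z w, w ∈ Submodule.span ℂ {x₀, x₁, x₂} → br z w = 0 := by
    intro z w hw
    obtain ⟨p, q, r, rfl⟩ := mem w hw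
    simp [hzx0, hzx1, hzx2]
  -- if `[s,y] ∈ I` or `[y,s] ∈ I` then the right multiplications by `s` and `y` commute
  have comm : ∀ z s y, br s y ∈ Submodule.span ℂ {x₀, x₁, x₂} → br (br z s) y = br (br z y) s := by
    intro z s y hsy
    have := leib z s y
    rw [zI z _ hsy] at this
    exact (sub_eq_zero.1 this.symm)
  have theta : ∀ y, br e y ∈ Submodule.span ℂ {x₀, x₁, x₂} →
      br f y ∈ Submodule.span ℂ {x₀, x₁, x₂} →
      ∃ m : ℂ, br e y = m • x₀ ∧ br h y = m • x₁ ∧ br f y = (m / 2) • x₂ := by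
    intro y he hf
    obtain ⟨m, hm⟩ := high _ he (by rw [← comm e e y he, hee]; simp)
    have h1 : br h y = m • x₁ := by
      rw [← hef, comm e f y hf, hm]; simp [hx0f]
    refine ⟨m, hm, h1, ?_⟩
    have h2 : (2 : ℂ) • br f y = m • x₂ := by
      have := comm h f y hf
      rw [hhf, h1] at this
      simpa [hx1f] using this
    calc br f y = (1 / 2 : ℂ) • (2 : ℂ) • br f y := by module
      _ = (m / 2) • x₂ := by rw [h2]; module
  have scal : ∀ y, br e y ∈ Submodule.span ℂ {x₀, x₁, x₂} →
      br f y ∈ Submodule.span ℂ {x₀, x₁, x₂} →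
      br x₀ y ∈ Submodule.span ℂ {x₀, x₁, x₂} →
      ∃ m : ℂ, br x₀ y = m • x₀ ∧ br x₁ y = m • x₁ ∧ br x₂ y = m • x₂ := by
    intro y he hf hx
    obtain ⟨m, hm⟩ := high _ hx (by rw [← comm x₀ e y he, hx0e]; simp)
    have h1 : br x₁ y = m • x₁ := by
      rw [← hx0f, comm x₀ f y hf, hm]; simp
    refine ⟨m, hm, h1, ?_⟩
    rw [← hx1f, comm x₁ f y hf, h1]; simp
  obtain ⟨lam, hey1', hhy1', hfy1'⟩ := theta y₁ hey1 hfy1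
  obtain ⟨mu, hey2', hhy2', hfy2'⟩ := theta y₂ hey2 hfy2
  obtain ⟨b, hb0, hb1, hb2⟩ := scal y₁ hey1 hfy1 hx0y1
  obtain ⟨a, ha0, ha1, ha2⟩ := scal y₂ hey2 hfy2 hx0y2
  have x0ne : x₀ ≠ 0 := by
    intro h0
    have := ind3 1 0 0 (by simp [h0])
    simp at this
  have hbr12 : ∀ z, br z (br y₁ y₂) = br z y₁ := by
    intro z
    have := zI z _ hy12
    rw [map_sub] at this
    exact sub_eq_zero.1 this
  have hb : b = 0 := by
    have := leib x₀ y₁ y₂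
    rw [hbr12, hb0, ha0] at this
    simp only [map_smul, LinearMap.smul_apply, hb0, ha0] at this
    rw [smul_comm, sub_self] at this
    exact (smul_eq_zero.1 this).resolve_right x0ne
  subst hb
  have hlam : lam = a * lam := by
    have := leib e y₁ y₂
    rw [hbr12, hey1', hey2'] at this
    simp only [map_smul, LinearMap.smul_apply, hb0, ha0, zero_smul, smul_zero, sub_zero,
      smul_smul] at this
    have h2 := sub_eq_zero.2 this
    rw [← sub_smul] at h2
    have := (smul_eq_zero.1 h2).resolve_right x0ne
    linear_combination this
  have Iy1 : ∀ w, w ∈ Submodule.span ℂ {x₀, x₁, x₂} → br w y₁ = 0 := by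
    intro w hw
    obtain ⟨p, q, r, rfl⟩ := mem w hw
    simp [hb0, hb1, hb2]
  have y1s : ∀ s, br y₁ s ∈ Submodule.span ℂ {x₀, x₁, x₂} →
      br y₂ s ∈ Submodule.span ℂ {x₀, x₁, x₂} → br y₁ s = 0 := by
    intro s h1 h2
    have := leib y₂ y₁ s
    rw [zI _ _ h1, hy21, Iy1 _ h2] at this
    simpa using this.symm
  have hy1e' := y1s e hy1e hy2e
  have hy1f' := y1s f hy1f hy2f
  have hy1h' := y1s h hy1h hy2h
  -- adjust `y₂`
  obtain ⟨v, hv, hve, hvf, hvh⟩ : ∃ v, v ∈ Submodule.span ℂ {x₀, x₁, x₂} ∧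
      br (y₂ + v) e = 0 ∧ br (y₂ + v) f = 0 ∧ br (y₂ + v) h = 0 := by
    obtain ⟨p0, p1, p2, hp⟩ := mem _ hy2e
    obtain ⟨q0, q1, q2, hq⟩ := mem _ hy2f
    obtain ⟨r0, r1, r2, hr⟩ := mem _ hy2h
    have e1 := leib y₂ h f
    rw [hhf, map_smul, hq, hr, brf, brh] at e1
    obtain ⟨a1, a2, a3⟩ := ind3 (4 * q0) (2 * q1 - r0) (-r1)
      (Eq.trans (by module) (sub_eq_zero.2 e1))
    have e2 := leib y₂ e f
    rw [hef, hp, hq, hr, brf, bre] at e2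
    obtain ⟨b1, b2, b3⟩ := ind3 (r0 - 2 * q1) (r1 - p0 - 2 * q2) (r2 - p1)
      (Eq.trans (by module) (sub_eq_zero.2 e2))
    have e3 := leib y₂ e h
    rw [heh, map_smul, hp, hr, bre, brh] at e3
    obtain ⟨c1, c2, c3⟩ := ind3 (-2 * r1) (2 * p1 - 2 * r2) (4 * p2)
      (Eq.trans (by module) (sub_eq_zero.2 e3))
    have hq0 : q0 = 0 := by simpa using a1
    have hr1 : r1 = 0 := by simpa using a3
    have hp2 : p2 = 0 := by simpa using c3
    have hr0 : r0 = 2 * q1 := by linear_combination b1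
    have hr2 : r2 = p1 := by linear_combination b3
    have hp0 : p0 = -2 * q2 := by linear_combination hr1 - b2
    subst hq0 hr1 hp2 hr0 hr2 hp0
    refine ⟨(-q1) • x₀ + (-q2) • x₁ + (r2 / 2) • x₂,
      Submodule.mem_span_triple.2 ⟨_, _, _, rfl⟩, ?_, ?_, ?_⟩
    · rw [map_add, LinearMap.add_apply, hp, bre]; module
    · rw [map_add, LinearMap.add_apply, hq, brf]; module
    · rw [map_add, LinearMap.add_apply, hr, brh]; module
  obtain ⟨y, hy⟩ : ∃ y, y = y₂ + v := ⟨_, rfl⟩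
  rw [← hy] at hve hvf hvh
  have bry : ∀ z, br z y = br z y₂ := by
    intro z
    rw [hy, map_add, zI z v hv, add_zero]
  have ssy : ∀ s, br s y = br s y₂ := bry
  have hfyI : br f y ∈ Submodule.span ℂ {x₀, x₁, x₂} := by rw [bry]; exact hfy2
  have hhyI : br h y ∈ Submodule.span ℂ {x₀, x₁, x₂} := by rw [bry]; exact hhy2
  have Iy2 : ∀ w, w ∈ Submodule.span ℂ {x₀, x₁, x₂} → br w y ∈ Submodule.span ℂ {x₀, x₁, x₂} := by
    intro w hw
    obtain ⟨p, q, r, rfl⟩ := mem w hw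
    rw [bry]
    refine Submodule.mem_span_triple.2 ⟨a * p, a * q, a * r, ?_⟩
    simp only [map_add, map_smul, LinearMap.add_apply, LinearMap.smul_apply, ha0, ha1, ha2]
    module
  have hyy : br y y = 0 := by
    apply inv0
    · have h1 : br y y = br y₂ y₂ + br v y := by
        conv_lhs => rw [bry, hy, map_add, LinearMap.add_apply, ← bry v]
      rw [h1]
      exact Submodule.add_mem _ hy2y2 (Iy2 v hv)
    · rw [← comm y f y hfyI, hvf]; simp
    · rw [← comm y h y hhyI, hvh]; simp
  have hy11 : br y₁ y₁ = 0 := by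
    apply inv0 _ hy1y1
    · rw [← comm y₁ f y₁ hfy1, hy1f']; simp
    · rw [← comm y₁ h y₁ hhy1, hy1h']; simp
  have hy1y : br y₁ y = y₁ := by
    rw [bry]
    apply sub_eq_zero.1
    apply inv0 _ hy12
    · rw [map_sub, LinearMap.sub_apply, ← comm y₁ f y₂ hfy2, hy1f']; simp
    · rw [map_sub, LinearMap.sub_apply, ← comm y₁ h y₂ hhy2, hy1h']; simp
  have hyy1 : br y y₁ = -y₁ := by
    rw [hy, map_add, LinearMap.add_apply, Iy1 v hv, hy21, add_zero]
  have hspan' : Submodule.span ℂ (Set.range ![e, h, f, x₀, x₁, x₂, y₁, y]) = ⊤ := by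
    rw [eq_top_iff, ← hspan, Submodule.span_le]
    simp only [Matrix.range_cons, Matrix.range_empty, Set.union_empty, Set.union_subset_iff,
      Set.singleton_subset_iff, SetLike.mem_coe]
    have hI : Submodule.span ℂ {x₀, x₁, x₂} ≤
        Submodule.span ℂ ({e} ∪ ({h} ∪ ({f} ∪ ({x₀} ∪ ({x₁} ∪ ({x₂} ∪ ({y₁} ∪ {y}))))))) := by
      apply Submodule.span_mono
      intro z hz
      simp only [Set.mem_insert_iff, Set.mem_singleton_iff, Set.mem_union] at hz ⊢
      tauto
    refine ⟨?_, ?_, ?_, ?_, ?_, ?_, ?_, ?_⟩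
    on_goal 8 =>
      have h1 : y₂ = y - v := by rw [hy]; abel
      rw [h1]
      refine Submodule.sub_mem _ (Submodule.subset_span ?_) (hI hv)
      simp
    all_goals exact Submodule.subset_span (by simp)
  have fin : ∀ lam' mu' c d t : ℂ, c ≠ 0 → d ≠ 0 → d * lam = lam' * c →
      mu + t * lam = mu' * c →
      ∃ φ : L ≃ₗ[ℂ] (Fin 8 → ℂ), ∀ u v, φ (br u v) = lbr lam' mu' a (φ u) (φ v) := by
    intro lam' mu' c d t hc hd hl hm
    refine iso_of_rescale br lam mu a lam' mu' c d t hc hd hl hm hrank e h f x₀ x₁ x₂ y₁ y hspan'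
      heh hhf hef hhe hfh hfe hee hff hhh hx0h hx1h hx2h hx0f hx1f hx2f hx0e hx1e hx2e
      hzx0 hzx1 hzx2 hey1' hhy1' hfy1' ?_ ?_ ?_ hy1e' hy1h' hy1f' hve hvh hvf
      ?_ ?_ ?_ ?_ ?_ ?_ hy11 hyy hy1y hyy1
    · rw [bry, hey2']
    · rw [bry, hhy2']
    · rw [bry, hfy2']
    · rw [hb0, zero_smul]
    · rw [hb1, zero_smul]
    · rw [hb2, zero_smul]
    · rw [bry, ha0]
    · rw [bry, ha1]
    · rw [bry, ha2]
  by_cases hl0 : lam = 0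
  · right
    by_cases hm0 : mu = 0
    · right
      exact ⟨a, fin 0 0 1 1 0 one_ne_zero one_ne_zero (by simp [hl0]) (by simp [hm0])⟩
    · left
      exact ⟨a, fin 0 1 mu 1 0 hm0 one_ne_zero (by simp [hl0]) (by simp)⟩
  · left
    have ha : a = 1 := by
      have : (a - 1) * lam = 0 := by linear_combination -hlam
      exact sub_eq_zero.1 ((mul_eq_zero.1 this).resolve_right hl0)
    have := fin 1 0 1 lam⁻¹ (-mu / lam) one_ne_zero (inv_ne_zero hl0) (by field_simp)
      (by field_simp; ring)
    rwa [ha] at this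
end

section
/- For all λ, μ ∈ ℂ with λ ≠ 0, the Leibniz algebra L(λ,μ,1) is isomorphic to L(1,0,1). (An isomorphism is obtained from the basis change y₁' = (1/λ)y₁, y₂' = −(μ/λ)y₁ + y₂.) -/
/-- `LIso (λ,μ,a) (λ',μ',a')` means the algebras `L(λ,μ,a)` and `L(λ',μ',a')` are
isomorphic (as algebras over `ℂ`). -/
def LIso (p q : ℂ × ℂ × ℂ) : Prop :=
  ∃ φ : (Fin 8 → ℂ) ≃ₗ[ℂ] (Fin 8 → ℂ),
    ∀ u v, φ (lbr p.1 p.2.1 p.2.2 u v) = lbr q.1 q.2.1 q.2.2 (φ u) (φ v)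

set_option maxHeartbeats 4000000 in
/-- Coordinate formula for the bracket. -/
theorem lbr_eq (lam mu a : ℂ) (u v : Fin 8 → ℂ) : lbr lam mu a u v =
    ![2 * (u 0 * v 1) - 2 * (u 1 * v 0),
      u 0 * v 2 - u 2 * v 0,
      2 * (u 1 * v 2) - 2 * (u 2 * v 1),
      -2 * (u 4 * v 0) + 2 * (u 3 * v 1) + lam * (u 0 * v 6) + mu * (u 0 * v 7)
        + a * (u 3 * v 7),
      -2 * (u 5 * v 0) + u 3 * v 2 + lam * (u 1 * v 6) + mu * (u 1 * v 7)
        + a * (u 4 * v 7),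
      u 4 * v 2 - 2 * (u 5 * v 1) + lam / 2 * (u 2 * v 6) + mu / 2 * (u 2 * v 7)
        + a * (u 5 * v 7),
      u 6 * v 7 - u 7 * v 6,
      0] := by
  unfold lbr
  simp only [Fin.sum_univ_eight]
  ext k
  fin_cases k <;> simp [sc, b8] <;> ring

/-- The basis change as a linear equivalence. -/
noncomputable def phi8 (lam mu : ℂ) (hlam : lam ≠ 0) : (Fin 8 → ℂ) ≃ₗ[ℂ] (Fin 8 → ℂ) where
  toFun u := ![u 0, u 1, u 2, u 3, u 4, u 5, lam * u 6 + mu * u 7, u 7]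
  invFun u := ![u 0, u 1, u 2, u 3, u 4, u 5, (u 6 - mu * u 7) / lam, u 7]
  map_add' u v := by
    ext k
    fin_cases k <;> simp <;> ring
  map_smul' c u := by
    ext k
    fin_cases k <;> simp <;> ring
  left_inv u := by
    ext k
    fin_cases k <;> simp [hlam]
  right_inv u := by
    ext k
    fin_cases k <;> simp <;> field_simp <;> ring

theorem phi8_apply (lam mu : ℂ) (hlam : lam ≠ 0) (u : Fin 8 → ℂ) :
    phi8 lam mu hlam u = ![u 0, u 1, u 2, u 3, u 4, u 5, lam * u 6 + mu * u 7, u 7] := rfl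

/-- For all `λ, μ ∈ ℂ` with `λ ≠ 0`, the Leibniz algebra `L(λ,μ,1)` is
isomorphic to `L(1,0,1)` (via the basis change `y₁' = (1/λ)y₁`, `y₂' = -(μ/λ)y₁ + y₂`). -/
theorem L_lam_mu_one_iso_L101 (lam mu : ℂ) (hlam : lam ≠ 0) :
    LIso (lam, mu, 1) (1, 0, 1) := by
  refine ⟨phi8 lam mu hlam, fun u v => ?_⟩
  simp only [lbr_eq, phi8_apply]
  ext k
  fin_cases k <;> simp <;> ring
end

section
/- For all μ ∈ ℂ with μ ≠ 0 and all a ∈ ℂ, the Leibniz algebra L(0,μ,a) is isomorphic to L(0,1,a). (An isomorphism is obtained by rescaling the basis x_0, x_1, x_2 of I.) -/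
set_option maxHeartbeats 4000000 in
/-- Coordinates of the bracket of `L(0,μ,a)`. -/
lemma lbr_zero (mu a : ℂ) (u v : Fin 8 → ℂ) :
    lbr 0 mu a u v = ![2 * (u 0 * v 1) - 2 * (u 1 * v 0),
      u 0 * v 2 - u 2 * v 0,
      2 * (u 1 * v 2) - 2 * (u 2 * v 1),
      -2 * (u 4 * v 0) + 2 * (u 3 * v 1) + mu * (u 0 * v 7) + a * (u 3 * v 7),
      -2 * (u 5 * v 0) + u 3 * v 2 + mu * (u 1 * v 7) + a * (u 4 * v 7),
      u 4 * v 2 - 2 * (u 5 * v 1) + mu / 2 * (u 2 * v 7) + a * (u 5 * v 7),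
      u 6 * v 7 - u 7 * v 6,
      0] := by
  ext k
  fin_cases k <;> simp [lbr, Fin.sum_univ_eight, sc, b8] <;> ring

/-- Rescaling factors: `c` on `x₀, x₁, x₂` and `1` elsewhere. -/
noncomputable def scaleVec (c : ℂ) : Fin 8 → ℂ := ![1, 1, 1, c, c, c, 1, 1]

lemma scaleVec_ne_zero (c : ℂ) (hc : c ≠ 0) (i : Fin 8) : scaleVec c i ≠ 0 := by
  fin_cases i <;> simp [scaleVec, hc]

/-- For all `μ ∈ ℂ` with `μ ≠ 0` and all `a ∈ ℂ`, the Leibniz algebra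
`L(0,μ,a)` is isomorphic to `L(0,1,a)` (via a rescaling of the basis `x₀, x₁, x₂` of `I`). -/
theorem L_zero_mu_a_iso_L01a (mu a : ℂ) (hmu : mu ≠ 0) :
    LIso (0, mu, a) (0, 1, a) := by
  refine ⟨LinearEquiv.piCongrRight (fun i => LinearEquiv.smulOfNeZero ℂ ℂ (scaleVec mu⁻¹ i)
    (scaleVec_ne_zero _ (inv_ne_zero hmu) i)), fun u v => ?_⟩
  simp only [lbr_zero]
  ext k
  fin_cases k <;> simp [scaleVec] <;> field_simp
end
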